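/- Let p be a prime and F a field of characteristic p that is p-cyclic reducible. Let A be a central simple F-algebra with exp A = p and ind A = p^n for a positive integer n. Then for each 1 ≤ i ≤ n there exist purely inseparable field extensions K_i/F with K_i^p ⊆ F and K_{i−1} ⊆ K_i (where K_0 = F) such that ind A_{K_i} ≤ p^{n−i} and [K_i:F] ≤ p^{2·p^{n−1} − p^{n−i}}. -/

import Mathlib

open scoped TensorProduct

/-- A finite-dimensional central simple algebra over a field `F`. -/
def IsCSA (F A : Type) [Field F] [Ring A] [Algebra F A] : Prop :=
  Algebra.IsCentral F A ∧ IsSimpleRing A ∧ FiniteDimensional F A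

/-- An `F`-algebra is split if it is isomorphic to a matrix algebra over `F`. -/
def IsSplitAlg (F A : Type) [Field F] [Ring A] [Algebra F A] : Prop :=
  ∃ n : ℕ, 0 < n ∧ Nonempty (A ≃ₐ[F] Matrix (Fin n) (Fin n) F)

/-- Brauer equivalence of two algebras over a field `F`. -/
def IsBrauerEquiv (F A B : Type) [Field F] [Ring A] [Algebra F A] [Ring B] [Algebra F B] :
    Prop :=
  ∃ n m : ℕ, 0 < n ∧ 0 < m ∧
    Nonempty ((Matrix (Fin n) (Fin n) A) ≃ₐ[F] (Matrix (Fin m) (Fin m) B))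

/-- `A` has exponent `e`: `e` is the least positive integer such that the `e`-fold tensor
power of `A` over `F` is split. -/
def HasExponent (F A : Type) [Field F] [Ring A] [Algebra F A] (e : ℕ) : Prop :=
  0 < e ∧ IsSplitAlg F (⨂[F] _ : Fin e, A) ∧
    ∀ k : ℕ, 0 < k → IsSplitAlg F (⨂[F] _ : Fin k, A) → e ≤ k

/-- `A` has (Schur) index `d`: `A` is isomorphic to a matrix algebra over a division
algebra of dimension `d ^ 2` over `F`. -/
def HasIndex (F A : Type) [Field F] [Ring A] [Algebra F A] (d : ℕ) : Prop :=
  ∃ (D : Type) (_ : DivisionRing D) (_ : Algebra F D) (m : ℕ), 0 < m ∧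
    Nonempty (A ≃ₐ[F] Matrix (Fin m) (Fin m) D) ∧ Module.finrank F D = d ^ 2

/-- The (Schur) index of `A` is at most `d`. -/
def IndexLE (F A : Type) [Field F] [Ring A] [Algebra F A] (d : ℕ) : Prop :=
  ∃ e : ℕ, e ≤ d ∧ HasIndex F A e

/-- `A` is the cyclic (symbol) algebra `[a, b)_{p,F}` of degree `p` in characteristic `p`:
it has dimension `p ^ 2` over `F` and is generated by elements `i`, `j` subject to
`i ^ p - i = a`, `j ^ p = b`, `j * i = (i - 1) * j`. -/
def IsCyclicAlgWith (p : ℕ) (F A : Type) [Field F] [Ring A] [Algebra F A] (a b : F) : Prop :=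
  b ≠ 0 ∧ Module.finrank F A = p ^ 2 ∧
    ∃ i j : A, i ^ p - i = algebraMap F A a ∧ j ^ p = algebraMap F A b ∧
      j * i = (i - 1) * j ∧ Algebra.adjoin F {i, j} = ⊤

/-- `A` is a cyclic algebra of degree `p`, i.e. of the form `[a, b)_{p,F}`. -/
def IsCyclicPAlg (p : ℕ) (F A : Type) [Field F] [Ring A] [Algebra F A] : Prop :=
  ∃ a b : F, IsCyclicAlgWith p F A a b

/-- The `p`-symbol length of `A` is at most `m`: `A` is Brauer equivalent to a tensor
product of at most `m` cyclic `F`-algebras of degree `p`. -/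
def SymbolLengthLE (p : ℕ) (F A : Type) [Field F] [Ring A] [Algebra F A] (m : ℕ) : Prop :=
  ∃ k : ℕ, k ≤ m ∧ ∃ (D : Fin k → Type) (_ : ∀ i, Ring (D i)) (_ : ∀ i, Algebra F (D i)),
    (∀ i, IsCyclicPAlg p F (D i)) ∧ IsBrauerEquiv F A (⨂[F] i, D i)

/-- `M` is a compositum `LK` of `L` and `K` over `F`: it is generated as an `F`-algebra by
the images of `L` and `K`. -/
def IsCompositum (F L K M : Type) [Field F] [Field L] [Field K] [Field M]
    [Algebra F L] [Algebra F K] [Algebra F M] [Algebra L M] [Algebra K M]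
    [IsScalarTower F L M] [IsScalarTower F K M] : Prop :=
  (IsScalarTower.toAlgHom F L M).range ⊔ (IsScalarTower.toAlgHom F K M).range = ⊤

/-- A cyclic algebra of degree `m` over `F`: a central simple `F`-algebra of degree `m`
containing a cyclic field extension of `F` of degree `m` (as a maximal subfield). -/
def IsCyclicAlgebra (F A : Type) [Field F] [Ring A] [Algebra F A] (m : ℕ) : Prop :=
  IsCSA F A ∧ Module.finrank F A = m ^ 2 ∧
  ∃ (L : Type) (_ : Field L) (_ : Algebra F L), IsGalois F L ∧ IsCyclic (L ≃ₐ[F] L) ∧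
    Module.finrank F L = m ∧ Nonempty (L →ₐ[F] A)

/-- `L/F` is a `p`-extension: there is a tower of intermediate fields from `F` to `L`
each step of which is a cyclic extension of degree `p`. -/
def IsPExtension (p : ℕ) (F L : Type) [Field F] [Field L] [Algebra F L] : Prop :=
  ∃ (n : ℕ) (T : Fin (n + 1) → IntermediateField F L),
    T 0 = ⊥ ∧ T (Fin.last n) = ⊤ ∧
    ∀ i : Fin n, ∃ h : T i.castSucc ≤ T i.succ,
      IsGalois (T i.castSucc) (IntermediateField.extendScalars h) ∧
      IsCyclic ((IntermediateField.extendScalars h) ≃ₐ[T i.castSucc]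
        (IntermediateField.extendScalars h)) ∧
      Module.finrank (T i.castSucc) (IntermediateField.extendScalars h) = p

/-- `F` is `p`-cyclic reducible: for every central simple `F`-algebra `A` of exponent `p`
and every purely inseparable extension `K/F` with `K ^ p ⊆ F`, either `A_K` is split, or
there is a separable extension `L/F` of degree `ind (A_K) / p` such that `A_{LK}` is
Brauer equivalent to a cyclic `LK`-algebra of degree `p`. -/
def IsPCyclicReducible (p : ℕ) (F : Type) [Field F] : Prop :=
  ∀ (A : Type) [Ring A] [Algebra F A], IsCSA F A → HasExponent F A p →
  ∀ (K : Type) [Field K] [Algebra F K], IsPurelyInseparable F K →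
    (∀ z : K, z ^ p ∈ (algebraMap F K).range) →
    IsSplitAlg K (K ⊗[F] A) ∨
    ∃ d : ℕ, HasIndex K (K ⊗[F] A) (p * d) ∧
      ∃ (L : Type) (_ : Field L) (_ : Algebra F L), Algebra.IsSeparable F L ∧
        Module.finrank F L = d ∧
        ∃ (M : Type) (_ : Field M) (_ : Algebra F M) (_ : Algebra L M) (_ : Algebra K M)
          (_ : IsScalarTower F L M) (_ : IsScalarTower F K M),
          IsCompositum F L K M ∧
          ∃ (C : Type) (_ : Ring C) (_ : Algebra M C),
            IsCyclicPAlg p M C ∧ IsBrauerEquiv M (M ⊗[F] A) C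

/-- `F` is `p`-reducible: for every central simple `F`-algebra `A` of exponent `p`
and every purely inseparable extension `K/F` with `K ^ p ⊆ F`, either `A_K` is split, or
there is a separable extension `L/F` of degree `ind (A_K) / p` with `ind A_{LK} = p`. -/
def IsPReducible (p : ℕ) (F : Type) [Field F] : Prop :=
  ∀ (A : Type) [Ring A] [Algebra F A], IsCSA F A → HasExponent F A p →
  ∀ (K : Type) [Field K] [Algebra F K], IsPurelyInseparable F K →
    (∀ z : K, z ^ p ∈ (algebraMap F K).range) →
    IsSplitAlg K (K ⊗[F] A) ∨
    ∃ d : ℕ, HasIndex K (K ⊗[F] A) (p * d) ∧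
      ∃ (L : Type) (_ : Field L) (_ : Algebra F L), Algebra.IsSeparable F L ∧
        Module.finrank F L = d ∧
        ∃ (M : Type) (_ : Field M) (_ : Algebra F M) (_ : Algebra L M) (_ : Algebra K M)
          (_ : IsScalarTower F L M) (_ : IsScalarTower F K M),
          IsCompositum F L K M ∧ HasIndex M (M ⊗[F] A) p

section Auxiliary

open Module Polynomial

theorem finrank_le_of_matrix_action {K D W : Type} [Field K] [DivisionRing D] [Algebra K D]
    [AddCommGroup W] [Module K W] [FiniteDimensional K W] [Nontrivial W] {m : ℕ}
    (ρ : Matrix (Fin m) (Fin m) D →ₐ[K] Module.End K W) :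
    m * finrank K D ≤ finrank K W := by
  obtain ⟨i₀, w, hw⟩ : ∃ (i : Fin m) (w : W), ρ (Matrix.single i i 1) w ≠ 0 := by
    by_contra! h
    obtain ⟨w, hw⟩ := exists_ne (0 : W)
    apply hw
    have h1 : ρ 1 w = w := by rw [map_one]; rfl
    rw [← h1, ← Matrix.sum_single_one, map_sum, LinearMap.sum_apply]
    exact Finset.sum_eq_zero fun i _ => h i w
  let φ : (Fin m → D) →ₗ[K] W :=
    { toFun := fun d => ρ (∑ i, Matrix.single i i₀ (d i)) w
      map_add' := fun x y => by
        simp [Matrix.single_add, Finset.sum_add_distrib]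
      map_smul' := fun c x => by
        have : (∑ i, Matrix.single i i₀ ((c • x) i) : Matrix (Fin m) (Fin m) D)
            = c • ∑ i, Matrix.single i i₀ (x i) := by
          simp [Finset.smul_sum, Matrix.smul_single]
        rw [this, map_smul]; rfl }
  have hφ : Function.Injective φ := by
    rw [injective_iff_map_eq_zero]
    intro d hd
    by_contra hne
    obtain ⟨k, hk⟩ := Function.ne_iff.mp hne
    apply hw
    have h2 : (Matrix.single i₀ k (d k)⁻¹ : Matrix (Fin m) (Fin m) D) *
        (∑ i, Matrix.single i i₀ (d i)) = Matrix.single i₀ i₀ 1 := by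
      rw [Finset.mul_sum, Finset.sum_eq_single k]
      · simp [inv_mul_cancel₀ (show d k ≠ 0 from hk)]
      · intro b _ hb
        exact Matrix.single_mul_single_of_ne _ _ _ _ hb.symm _
      · simp
    have hd' : ρ (∑ i, Matrix.single i i₀ (d i)) w = 0 := hd
    rw [← h2, map_mul, Module.End.mul_apply, hd', map_zero]
  have hfin : FiniteDimensional K (Fin m → D) := FiniteDimensional.of_injective φ hφ
  have : FiniteDimensional K D := by
    refine FiniteDimensional.of_injective (LinearMap.single K (fun _ : Fin m => D) i₀) ?_
    exact Pi.single_injective (M := fun _ : Fin m => D) i₀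
  calc m * finrank K D = finrank K (Fin m → D) := by
        rw [Module.finrank_pi_fintype]; simp
    _ ≤ _ := LinearMap.finrank_le_finrank_of_injective hφ

theorem HasIndex.mul_eq_of_finrank {K B : Type} [Field K] [Ring B] [Algebra K B] {e q : ℕ}
    (h : HasIndex K B e) (hq : finrank K B = q ^ 2) :
    ∃ (D : Type) (_ : DivisionRing D) (_ : Algebra K D) (m : ℕ), 0 < m ∧
    Nonempty (B ≃ₐ[K] Matrix (Fin m) (Fin m) D) ∧ Module.finrank K D = e ^ 2 ∧ m * e = q := by
  obtain ⟨D, _, _, m, hm, ⟨φ⟩, hD⟩ := h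
  refine ⟨D, _, _, m, hm, ⟨φ⟩, hD, ?_⟩
  have := φ.toLinearEquiv.finrank_eq
  rw [hq, Module.finrank_matrix, hD] at this
  have h2 : (m * e) ^ 2 = q ^ 2 := by rw [this]; simp; ring
  exact Nat.pow_left_injective (n := 2) (by norm_num) h2

theorem HasIndex.mul_le_finrank {K B W : Type} [Field K] [Ring B] [Algebra K B] {e q : ℕ}
    (h : HasIndex K B e) (hq : finrank K B = q ^ 2)
    [AddCommGroup W] [Module K W] [FiniteDimensional K W] [Nontrivial W]
    (ρ : B →ₐ[K] Module.End K W) : q * e ≤ finrank K W := by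
  obtain ⟨D, _, _, m, hm, ⟨φ⟩, hD, rfl⟩ := h.mul_eq_of_finrank hq
  have := finrank_le_of_matrix_action (ρ.comp φ.symm.toAlgHom)
  rw [hD] at this
  linarith [this, show m * e * e = m * e ^ 2 by ring]

/-- `A` acts by `F`-linear operators on an `r`-dimensional `N`-vector space. -/
def HasRep (F A N : Type) [Field F] [Ring A] [Algebra F A] [Field N] [Algebra F N] (r : ℕ) :
    Prop :=
  Nonempty (A →ₐ[F] Matrix (Fin r) (Fin r) N)

theorem HasRep.of_end {F A N U : Type} [Field F] [Ring A] [Algebra F A] [Field N] [Algebra F N]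
    [AddCommGroup U] [Module N U] [FiniteDimensional N U] [Module F U] [IsScalarTower F N U]
    {r : ℕ} (hr : finrank N U = r) (ρ : A →ₐ[F] Module.End N U) : HasRep F A N r :=
  ⟨((LinearMap.toMatrixAlgEquiv (finBasisOfFinrankEq N U hr)).toAlgHom.restrictScalars F).comp ρ⟩

theorem HasRep.mono {F A N N' : Type} [Field F] [Ring A] [Algebra F A] [Field N] [Algebra F N]
    [Field N'] [Algebra F N'] (g : N →ₐ[F] N') {r : ℕ} (h : HasRep F A N r) : HasRep F A N' r :=
  h.map fun ρ => g.mapMatrix.comp ρ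

theorem HasRep.of_matrix {F C N W : Type} [Field F] [Ring C] [Algebra F C] [Field N] [Algebra F N]
    [AddCommGroup W] [Module N W] [FiniteDimensional N W] [Module F W] [IsScalarTower F N W]
    {m r : ℕ} (hm : 0 < m)
    (ρ : Matrix (Fin m) (Fin m) C →ₐ[F] Module.End N W) (hr : finrank N W = m * r) :
    HasRep F C N r := by
  let o : Fin m := ⟨0, hm⟩
  let U : Submodule N W := LinearMap.range (ρ (Matrix.single o o 1))
  have hU : ∀ u ∈ U, ρ (Matrix.single o o 1) u = u := by
    rintro _ ⟨w, rfl⟩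
    rw [← Module.End.mul_apply, ← map_mul]; simp
  have hmem : ∀ (i : Fin m) (c : C) (w : W), ρ (Matrix.single o i c) w ∈ U := fun i c w =>
    ⟨ρ (Matrix.single o i c) w, by rw [← Module.End.mul_apply, ← map_mul]; simp⟩
  let ρ' : C →ₐ[F] Module.End N U :=
    { toFun := fun c => (ρ (Matrix.single o o c)).restrict (fun w _ => hmem o c w)
      map_one' := by ext u; exact hU u u.2
      map_mul' := fun x y => by
        ext u
        simp only [LinearMap.coe_restrict_apply, Module.End.mul_apply]
        rw [← Module.End.mul_apply, ← map_mul]; simp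
      map_zero' := by ext u; simp
      map_add' := fun x y => by ext u; simp [Matrix.single_add]
      commutes' := fun a => by
        ext u
        have : (Matrix.single o o (algebraMap F C a) : Matrix (Fin m) (Fin m) C)
            = a • Matrix.single o o 1 := by
          rw [Matrix.smul_single, Algebra.algebraMap_eq_smul_one]
        simp only [LinearMap.coe_restrict_apply, this, map_smul, LinearMap.smul_apply, hU u u.2]
        rw [Module.algebraMap_end_apply]; rfl }
  let e : W ≃ₗ[N] (Fin m → U) :=
    { toFun := fun w i => ⟨ρ (Matrix.single o i 1) w, hmem i 1 w⟩
      map_add' := fun x y => by ext i; simp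
      map_smul' := fun x y => by ext i; simp
      invFun := fun u => ∑ i, ρ (Matrix.single i o 1) (u i)
      left_inv := fun w => by
        simp only [← Module.End.mul_apply, ← map_mul]
        simp only [Matrix.single_mul_single_same, mul_one]
        rw [← LinearMap.sum_apply, ← map_sum, Matrix.sum_single_one, map_one]; rfl
      right_inv := fun u => by
        ext i
        simp only [map_sum, ← Module.End.mul_apply, ← map_mul]
        rw [Finset.sum_eq_single i]
        · simp only [Matrix.single_mul_single_same, mul_one]
          exact hU _ (u i).2
        · intro b _ hb
          rw [Matrix.single_mul_single_of_ne _ _ _ _ hb.symm]; simp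
        · simp }
  have he := e.finrank_eq
  rw [Module.finrank_pi_fintype, hr] at he
  simp only [Finset.sum_const, Finset.card_univ, Fintype.card_fin, smul_eq_mul] at he
  exact HasRep.of_end (Nat.eq_of_mul_eq_mul_left hm he).symm ρ'

theorem HasRep.of_brauerEquiv {M B C N : Type} [Field M] [Ring B] [Algebra M B] [Ring C]
    [Algebra M C] [Field N] [Algebra M N] {q r : ℕ}
    (h : IsBrauerEquiv M B C) (hB : finrank M B = q ^ 2) (hC : finrank M C = r ^ 2)
    (hrep : HasRep M B N q) : HasRep M C N r := by
  obtain ⟨n, m, hn, hm, ⟨φ⟩⟩ := h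
  obtain ⟨ρ⟩ := hrep
  have hdim : n * q = m * r := by
    have := φ.toLinearEquiv.finrank_eq
    rw [Module.finrank_matrix, Module.finrank_matrix, hB, hC] at this
    simp only [Fintype.card_fin] at this
    refine Nat.pow_left_injective (n := 2) (by norm_num) ?_
    simp only
    linarith [this, show (n * q) ^ 2 = n * n * q ^ 2 by ring,
      show (m * r) ^ 2 = m * m * r ^ 2 by ring]
  let g₁ : Matrix (Fin n) (Fin n) B →ₐ[M] Matrix (Fin n) (Fin n) (Matrix (Fin q) (Fin q) N) :=
    ρ.mapMatrix
  let g₂ : Matrix (Fin n) (Fin n) (Matrix (Fin q) (Fin q) N) →ₐ[M]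
      Matrix (Fin n × Fin q) (Fin n × Fin q) N :=
    (Matrix.compAlgEquiv (Fin n) (Fin q) N M).toAlgHom
  let g₃ : Matrix (Fin n × Fin q) (Fin n × Fin q) N →ₐ[M] Module.End N (Fin n × Fin q → N) :=
    (Matrix.toLinAlgEquiv' (R := N)).toAlgHom.restrictScalars M
  refine HasRep.of_matrix hm ((g₃.comp (g₂.comp g₁)).comp φ.symm.toAlgHom) ?_
  simp [← hdim]

theorem IsBrauerEquiv.symm' {M B C : Type} [Field M] [Ring B] [Algebra M B] [Ring C]
    [Algebra M C] (h : IsBrauerEquiv M B C) : IsBrauerEquiv M C B := by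
  obtain ⟨n, m, hn, hm, ⟨φ⟩⟩ := h
  exact ⟨m, n, hm, hn, ⟨φ.symm⟩⟩

theorem hasRep_baseChange_iff {F M A N : Type} [Field F] [Field M] [Algebra F M] [Ring A]
    [Algebra F A] [Field N] [Algebra F N] [Algebra M N] [IsScalarTower F M N] {r : ℕ} :
    HasRep M (M ⊗[F] A) N r ↔ HasRep F A N r := by
  constructor
  · rintro ⟨ρ⟩
    exact ⟨(ρ.restrictScalars F).comp Algebra.TensorProduct.includeRight⟩
  · rintro ⟨ρ⟩
    exact ⟨Algebra.TensorProduct.lift (Algebra.ofId M _) ρ fun x y => Algebra.commutes _ _⟩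

/-- The Artin–Schreier polynomial `X ^ p - X - a`. -/
noncomputable def asPoly {N : Type} [Field N] (p : ℕ) (a : N) : N[X] := X ^ p - X - C a

theorem natCast_injOn_range {N : Type} [Field N] {p : ℕ} [CharP N p] (r : N) :
    Set.InjOn (fun k : ℕ => r - (k : N)) (Finset.range p) := by
  intro x hx y hy hxy
  have : (x : N) = y := by simpa using hxy
  exact CharP.natCast_injOn_Iio N p (by simpa using hx) (by simpa using hy) this

section ArtinSchreier

variable {p : ℕ} [hp : Fact p.Prime] {N : Type} [Field N]

theorem asPoly_monic (a : N) : (asPoly p a).Monic := by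
  rw [asPoly, sub_sub]
  exact monic_X_pow_sub (by rw [degree_X_add_C]; exact_mod_cast hp.out.one_lt)

theorem asPoly_natDegree (a : N) : (asPoly p a).natDegree = p := by
  rw [asPoly, sub_sub]
  rw [natDegree_sub_eq_left_of_natDegree_lt] <;> rw [natDegree_X_pow]
  rw [natDegree_X_add_C]; exact hp.out.one_lt

theorem asPoly_comp [CharP N p] (a : N) (k : ℕ) :
    (asPoly p a).comp (X - C (k : N)) = asPoly p a := by
  have h : (C (k : N)) ^ p = (C (k : N) : N[X]) := by
    rw [← C_pow]
    congr 1
    exact map_natCast (frobenius N p) k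
  simp only [asPoly, sub_comp, pow_comp, X_comp, C_comp]
  rw [sub_pow_char, h]
  ring

theorem asPoly_eq_prod [CharP N p] (a r : N) (hr : r ^ p - r = a) :
    asPoly p a = ∏ k ∈ Finset.range p, (X - C (r - (k : N))) := by
  refine (eq_of_monic_of_dvd_of_natDegree_le (monic_prod_of_monic _ _ fun i _ => monic_X_sub_C _)
    (asPoly_monic a) ?_ ?_)
  · refine Finset.prod_dvd_of_coprime ?_ fun i _ => ?_
    · intro i hi j hj hij
      exact isCoprime_X_sub_C_of_isUnit_sub
        (sub_ne_zero.mpr fun h => hij (natCast_injOn_range r hi hj h)).isUnit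
    · rw [dvd_iff_isRoot]
      have h := congrArg (eval r) (asPoly_comp (p := p) a i)
      rw [eval_comp] at h
      simp only [IsRoot]
      simp only [eval_sub, eval_X, eval_C] at h
      rw [h]
      simp [asPoly, ← hr]
  · rw [asPoly_natDegree, natDegree_prod_of_monic _ _ fun i _ => monic_X_sub_C _]
    simp only [natDegree_X_sub_C]
    simp

/-- The coset of the prime field through `r` is invariant under natural shifts. -/
theorem prod_shift [CharP N p] {R : Type} [CommMonoid R] (g : N → R) (r : N) (j : ℕ) :
    ∏ k ∈ Finset.range p, g (r - j - k) = ∏ k ∈ Finset.range p, g (r - k) := by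
  induction j with
  | zero => simp
  | succ j ih =>
    rw [← ih]
    obtain ⟨n, hn⟩ := Nat.exists_eq_succ_of_ne_zero hp.out.ne_zero
    have hn0 : (n : N) + 1 = 0 := by
      have := CharP.cast_eq_zero N p
      rw [hn] at this
      simpa using this
    rw [hn, Nat.succ_eq_add_one, Finset.prod_range_succ, Finset.prod_range_succ']
    congr 1
    · refine Finset.prod_congr rfl fun k _ => ?_
      congr 1
      push_cast
      ring
    · congr 1
      push_cast
      linear_combination -hn0

/-- The residue of `B` modulo `X ^ p - X - a` has norm `b`. -/
def NormEq (p : ℕ) (a b : N) (B : N[X]) : Prop :=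
  asPoly p a ∣ ∏ k ∈ Finset.range p, B.comp (X - C (k : N)) - C b

theorem normEq_iff {Ω : Type} [Field Ω] [Algebra N Ω] [CharP Ω p] {a b : N} {B : N[X]}
    {r : Ω} (hr : r ^ p - r = algebraMap N Ω a) :
    NormEq p a b B ↔ ∏ k ∈ Finset.range p, aeval (r - (k : Ω)) B = algebraMap N Ω b := by
  have hev : ∀ x : Ω, aeval x (∏ k ∈ Finset.range p, B.comp (X - C (k : N)) - C b) =
      ∏ k ∈ Finset.range p, aeval (x - (k : Ω)) B - algebraMap N Ω b := by
    intro x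
    simp [aeval_comp]
  constructor
  · rintro ⟨Q, hQ⟩
    have h := hev r
    rw [hQ, map_mul] at h
    have h0 : aeval r (asPoly p a) = 0 := by simp [asPoly, hr]
    rw [h0, zero_mul] at h
    exact (sub_eq_zero.mp h.symm)
  · intro h
    have hmap : (asPoly p a).map (algebraMap N Ω) = asPoly p (algebraMap N Ω a) := by
      simp [asPoly]
    rw [NormEq, ← map_dvd_map (algebraMap N Ω) (algebraMap N Ω).injective (asPoly_monic a), hmap,
      asPoly_eq_prod _ r hr]
    refine Finset.prod_dvd_of_coprime ?_ fun i _ => ?_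
    · intro i hi j hj hij
      exact isCoprime_X_sub_C_of_isUnit_sub
        (sub_ne_zero.mpr fun h => hij (natCast_injOn_range r hi hj h)).isUnit
    · rw [dvd_iff_isRoot, IsRoot, eval_map_algebraMap, hev,
        prod_shift (fun x => aeval x B) r i, h, sub_self]

/-- An Artin–Schreier polynomial with a root represents everything as a norm. -/
theorem exists_normEq_of_root [CharP N p] {a r : N} (hr : r ^ p - r = a) (b : N) :
    ∃ B : N[X], NormEq p a b B := by
  classical
  refine ⟨Lagrange.interpolate (Finset.range p) (fun k : ℕ => r - (k : N))
    (fun k => if k = 0 then b else 1), ?_⟩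
  rw [normEq_iff (Ω := N) (r := r) (by simpa using hr)]
  have h : ∀ k ∈ Finset.range p, aeval (r - (k : N)) (Lagrange.interpolate (Finset.range p)
      (fun k : ℕ => r - (k : N)) (fun k => if k = 0 then b else 1)) = if k = 0 then b else 1 := by
    intro k hk
    rw [coe_aeval_eq_eval]
    exact Lagrange.eval_interpolate_at_node _ (natCast_injOn_range r) hk
  rw [Finset.prod_congr rfl h]
  simp [hp.out.pos]

theorem asPoly_irreducible [CharP N p] {a : N} (h : ∀ r : N, r ^ p - r ≠ a) :
    Irreducible (asPoly p a) := by
  let Ω := AlgebraicClosure N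
  have : CharP Ω p := charP_of_injective_algebraMap (algebraMap N Ω).injective p
  have hdeg : (asPoly p a).degree ≠ 0 := by
    rw [degree_eq_natDegree (asPoly_monic a).ne_zero, asPoly_natDegree]
    exact_mod_cast hp.out.ne_zero
  obtain ⟨r, hr⟩ := IsAlgClosed.exists_aeval_eq_zero Ω (asPoly p a) hdeg
  have hintegral : IsIntegral N r := ⟨asPoly p a, asPoly_monic a, hr⟩
  have hdvd : minpoly N r ∣ asPoly p a := minpoly.dvd N r hr
  have hr' : r ^ p - r = algebraMap N Ω a := by
    simpa [asPoly, sub_eq_zero] using hr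
  have hle : (minpoly N r).natDegree ≤ p := by
    rw [← asPoly_natDegree (p := p) a]
    exact natDegree_le_of_dvd hdvd (asPoly_monic a).ne_zero
  rcases hle.eq_or_lt with heq | hlt
  · rw [eq_of_monic_of_dvd_of_natDegree_le (minpoly.monic hintegral) (asPoly_monic a) hdvd
      (by rw [asPoly_natDegree, heq])]
    exact minpoly.irreducible hintegral
  exfalso
  set g := (minpoly N r).map (algebraMap N Ω) with hg
  have hgm : g.Monic := (minpoly.monic hintegral).map _
  have hroots : ∀ t ∈ g.roots, t - r ∈ (algebraMap N Ω).fieldRange := by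
    intro t ht
    have ht0 : aeval t (minpoly N r) = 0 := by
      have := (mem_roots hgm.ne_zero).mp ht
      rwa [hg, IsRoot, eval_map_algebraMap] at this
    have ht1 : aeval t (asPoly p a) = 0 := by
      obtain ⟨Q, hQ⟩ := hdvd
      rw [hQ, map_mul, ht0, zero_mul]
    have ht2 : t ^ p - t = algebraMap N Ω a := by simpa [asPoly, sub_eq_zero] using ht1
    refine (bot_le : (⊥ : Subfield Ω) ≤ _) ((Subfield.mem_bot_iff_pow_eq_self Ω p).mpr ?_)
    rw [sub_pow_char]
    linear_combination ht2 - hr'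
  have hsum : ∀ s : Multiset Ω, (∀ t ∈ s, t - r ∈ (algebraMap N Ω).fieldRange) →
      s.sum - s.card * r ∈ (algebraMap N Ω).fieldRange := by
    intro s
    induction s using Multiset.induction_on with
    | empty => intro _; simp
    | cons t s ih =>
      intro hs
      have h1 := hs t (Multiset.mem_cons_self t s)
      have h2 := ih fun x hx => hs x (Multiset.mem_cons_of_mem hx)
      have := Subfield.add_mem _ h1 h2
      convert this using 1
      rw [Multiset.sum_cons, Multiset.card_cons]
      push_cast
      ring
  have hspl : g.Splits := IsAlgClosed.splits g
  have hcard : g.roots.card = (minpoly N r).natDegree := by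
    rw [← hspl.natDegree_eq_card_roots, hg, natDegree_map]
  have hs1 : g.roots.sum ∈ (algebraMap N Ω).fieldRange := by
    have := hspl.nextCoeff_eq_neg_sum_roots_of_monic hgm
    rw [← neg_eq_iff_eq_neg.mpr this]
    refine Subfield.neg_mem _ ?_
    rw [hg, nextCoeff_map (algebraMap N Ω).injective]
    exact ⟨_, rfl⟩
  have hs2 := Subfield.sub_mem _ hs1 (hsum _ hroots)
  rw [sub_sub_cancel, hcard] at hs2
  have hne : ((minpoly N r).natDegree : Ω) ≠ 0 := by
    rw [Ne, CharP.cast_eq_zero_iff Ω p]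
    exact Nat.not_dvd_of_pos_of_lt (minpoly.natDegree_pos hintegral) hlt
  have hrm : r ∈ (algebraMap N Ω).fieldRange := by
    have h3 := Subfield.mul_mem _ (Subfield.inv_mem _ (natCast_mem (algebraMap N Ω).fieldRange
      (minpoly N r).natDegree)) hs2
    rwa [inv_mul_cancel_left₀ hne] at h3
  obtain ⟨r₀, rfl⟩ := hrm
  refine h r₀ ((algebraMap N Ω).injective ?_)
  simpa using hr'

end ArtinSchreier

section Cyclic

variable {p : ℕ} [hp : Fact p.Prime] {M R : Type} [Field M] [Ring R] [Algebra M R]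

/-- Moving `y` past a polynomial in `x` when `y * x = (x - 1) * y`. -/
theorem mul_aeval_of_shift {x y : R} (h : y * x = (x - 1) * y) (g : M[X]) :
    y * aeval x g = aeval x (g.comp (X - C 1)) * y := by
  induction g using Polynomial.induction_on' with
  | add f g hf hg => simp only [map_add, mul_add, add_comp, add_mul, hf, hg]
  | monomial n c =>
    have hpow : ∀ n : ℕ, y * x ^ n = (x - 1) ^ n * y := by
      intro n
      induction n with
      | zero => simp
      | succ n ih => rw [pow_succ, ← mul_assoc, ih, mul_assoc, h, pow_succ, mul_assoc]
    simp only [← C_mul_X_pow_eq_monomial, mul_comp, C_comp, pow_comp, X_comp, map_mul, map_pow,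
      map_sub, aeval_C, aeval_X, map_one]
    rw [← mul_assoc, ← Algebra.commutes, mul_assoc, hpow, mul_assoc]

theorem adjoin_le_span_of_relations {x y : R} {a b : M} (hx : x ^ p - x = algebraMap M R a)
    (hy : y ^ p = algebraMap M R b) (hxy : y * x = (x - 1) * y) :
    Subalgebra.toSubmodule (Algebra.adjoin M {x, y}) ≤
      Submodule.span M (Set.range fun st : Fin p × Fin p => x ^ (st.1 : ℕ) * y ^ (st.2 : ℕ)) := by
  set S := Submodule.span M
    (Set.range fun st : Fin p × Fin p => x ^ (st.1 : ℕ) * y ^ (st.2 : ℕ)) with hS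
  have key : ∀ (g : M[X]) (t : ℕ), aeval x g * y ^ t ∈ S := by
    intro g t
    have h0 : aeval x (asPoly p a) = 0 := by simp [asPoly, hx]
    have hyt : y ^ t = algebraMap M R (b ^ (t / p)) * y ^ (t % p) := by
      conv_lhs => rw [← Nat.div_add_mod t p, pow_add, pow_mul, hy, ← map_pow]
    have hg : aeval x g = ∑ s ∈ Finset.range p, (g %ₘ asPoly p a).coeff s • x ^ s := by
      conv_lhs => rw [← modByMonic_add_div g (asPoly p a), map_add, map_mul, h0, zero_mul, add_zero]
      refine aeval_eq_sum_range' ?_ x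
      have := natDegree_modByMonic_lt g (asPoly_monic (p := p) a) (by
        intro h
        have := asPoly_natDegree (p := p) a
        rw [h, natDegree_one] at this
        exact hp.out.ne_zero this.symm)
      rwa [asPoly_natDegree] at this
    rw [hyt, hg, Finset.sum_mul]
    refine Submodule.sum_mem _ fun s hs => ?_
    rw [smul_mul_assoc, ← mul_assoc, ← Algebra.commutes, mul_assoc, ← Algebra.smul_def]
    refine Submodule.smul_mem _ _ (Submodule.smul_mem _ _ (Submodule.subset_span ?_))
    exact ⟨(⟨s, Finset.mem_range.mp hs⟩, ⟨t % p, Nat.mod_lt _ hp.out.pos⟩), rfl⟩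
  have hclosed : ∀ z ∈ Algebra.adjoin M {x, y}, ∀ v ∈ S, z * v ∈ S := by
    intro z hz
    induction hz using Algebra.adjoin_induction with
    | mem z hz =>
      intro v hv
      induction hv using Submodule.span_induction with
      | mem v hv =>
        obtain ⟨⟨s, t⟩, rfl⟩ := hv
        rcases hz with rfl | rfl
        · have := key (X ^ ((s : ℕ) + 1)) t
          simpa [pow_succ', mul_assoc] using this
        · have := key ((X ^ (s : ℕ)).comp (X - C 1)) (t + 1)
          rw [pow_succ', ← mul_assoc, ← mul_aeval_of_shift hxy] at this
          simpa [mul_assoc] using this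
      | zero => simp
      | add u v _ _ hu hv => rw [mul_add]; exact S.add_mem hu hv
      | smul c v _ hv => rw [mul_smul_comm]; exact S.smul_mem c hv
    | algebraMap c => intro v hv; rw [← Algebra.smul_def]; exact S.smul_mem c hv
    | add u v _ _ hu hv => intro w hw; rw [add_mul]; exact S.add_mem (hu w hw) (hv w hw)
    | mul u v _ _ hu hv => intro w hw; rw [mul_assoc]; exact hu _ (hv w hw)
  intro z hz
  have h1 : (1 : R) ∈ S := by simpa using key 1 0
  simpa using hclosed z hz 1 h1

/-- The universal property of a cyclic algebra. -/
theorem IsCyclicAlgWith.exists_algHom {C : Type} [Ring C] [Algebra M C] {a b : M}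
    (hC : IsCyclicAlgWith p M C a b) {x y : R} (hx : x ^ p - x = algebraMap M R a)
    (hy : y ^ p = algebraMap M R b) (hxy : y * x = (x - 1) * y) : Nonempty (C →ₐ[M] R) := by
  obtain ⟨-, hdim, i, j, hi, hj, hij, htop⟩ := hC
  let T : Subalgebra M (C × R) := Algebra.adjoin M {(i, x), (j, y)}
  have hT := adjoin_le_span_of_relations (p := p) (M := M) (x := ((i, x) : C × R)) (y := (j, y))
    (a := a) (b := b) (Prod.ext hi hx) (Prod.ext hj hy) (Prod.ext hij hxy)
  have : FiniteDimensional M (Submodule.span M (Set.range fun st : Fin p × Fin p =>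
      ((i, x) : C × R) ^ (st.1 : ℕ) * (j, y) ^ (st.2 : ℕ))) :=
    FiniteDimensional.span_of_finite M (Set.finite_range _)
  have hfinT : FiniteDimensional M T := Submodule.finiteDimensional_of_le hT
  have hTdim : finrank M T ≤ p ^ 2 := by
    refine (Submodule.finrank_mono hT).trans ((finrank_range_le_card _).trans ?_)
    simp [sq]
  let π : T →ₐ[M] C := (AlgHom.fst M C R).comp T.val
  have hsurj : Function.Surjective π := by
    rw [← AlgHom.range_eq_top, eq_top_iff, ← htop, Algebra.adjoin_le_iff]
    rintro z (rfl | rfl)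
    · exact ⟨⟨(z, x), Algebra.subset_adjoin (Or.inl rfl)⟩, rfl⟩
    · exact ⟨⟨(z, y), Algebra.subset_adjoin (Or.inr rfl)⟩, rfl⟩
  have hfinC : FiniteDimensional M C := FiniteDimensional.of_finrank_pos (by
    rw [hdim]; exact pow_pos hp.out.pos 2)
  have hinj : Function.Injective π :=
    (LinearMap.injective_iff_surjective_of_finrank_eq_finrank (f := π.toLinearMap)
      (le_antisymm (hTdim.trans hdim.ge)
        (LinearMap.finrank_le_finrank_of_surjective (f := π.toLinearMap) hsurj))).mpr hsurj
  exact ⟨((AlgHom.snd M C R).comp T.val).comp (AlgEquiv.ofBijective π ⟨hinj, hsurj⟩).symm.toAlgHom⟩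

variable {N : Type} [Field N] [Algebra M N] [CharP N p]

/-- A solution of the norm equation splits the cyclic algebra. -/
theorem IsCyclicAlgWith.hasRep_of_normEq {E : Type} [Ring E] [Algebra M E] {a b : M}
    (hE : IsCyclicAlgWith p M E a b) {B : N[X]}
    (hB : NormEq p (algebraMap M N a) (algebraMap M N b) B) : HasRep M E N p := by
  set f := asPoly p (algebraMap M N a) with hf
  have hfm : f.Monic := asPoly_monic _
  let U := AdjoinRoot f
  have hfinU : FiniteDimensional N U := (AdjoinRoot.powerBasis' hfm).finite
  have hU : finrank N U = p := by
    rw [(AdjoinRoot.powerBasis' hfm).finrank, AdjoinRoot.powerBasis'_dim, asPoly_natDegree]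
  have hcomp : f.comp (X - C 1) = f := by
    simpa using asPoly_comp (p := p) (algebraMap M N a) 1
  have hroot : f.eval₂ (algebraMap N U) (AdjoinRoot.root f - 1) = 0 := by
    have h1 : aeval (AdjoinRoot.root f) (f.comp (X - C 1)) = 0 := by
      rw [hcomp]; simp
    rw [aeval_comp, aeval_def, aeval_sub, aeval_X, map_one, map_one] at h1
    exact h1
  let σ : U →ₐ[N] U := AdjoinRoot.liftAlgHom f (Algebra.ofId N U) (AdjoinRoot.root f - 1) hroot
  have hσ : ∀ g : N[X], σ (AdjoinRoot.mk f g) = AdjoinRoot.mk f (g.comp (X - C 1)) := by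
    intro g
    rw [← AdjoinRoot.aeval_eq, ← AdjoinRoot.aeval_eq, ← aeval_algHom_apply, aeval_comp]
    congr 2
    rw [aeval_sub, aeval_X, map_one, map_one]
    exact AdjoinRoot.liftAlgHom_root ..
  let x : Module.End N U := LinearMap.mulLeft N (AdjoinRoot.root f)
  let y : Module.End N U := LinearMap.mulLeft N (AdjoinRoot.mk f B) * σ.toLinearMap
  have hxm : ∀ g : N[X], x (AdjoinRoot.mk f g) = AdjoinRoot.mk f (X * g) := by
    intro g; simp [x]
  have hym : ∀ g : N[X], y (AdjoinRoot.mk f g) = AdjoinRoot.mk f (B * g.comp (X - C 1)) := by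
    intro g; simp [y, hσ]
  have hxpow : ∀ (t : ℕ) (g : N[X]),
      (x ^ t) (AdjoinRoot.mk f g) = AdjoinRoot.mk f (X ^ t * g) := by
    intro t g
    induction t with
    | zero => simp
    | succ t ih => rw [pow_succ', Module.End.mul_apply, ih, hxm, pow_succ', mul_assoc]
  have hypow : ∀ (t : ℕ) (g : N[X]), (y ^ t) (AdjoinRoot.mk f g) =
      AdjoinRoot.mk f ((∏ k ∈ Finset.range t, B.comp (X - C (k : N))) *
        g.comp (X - C (t : N))) := by
    intro t g
    induction t with
    | zero => simp
    | succ t ih =>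
      rw [pow_succ', Module.End.mul_apply, ih, hym, Finset.prod_range_succ']
      congr 1
      have hc : ∀ (k : ℕ) (g : N[X]), (g.comp (X - C (k : N))).comp (X - C 1) =
          g.comp (X - C ((k + 1 : ℕ) : N)) := by
        intro k g
        rw [comp_assoc]
        congr 1
        simp
        ring
      rw [mul_comp, prod_comp, hc, Finset.prod_congr rfl fun k _ => hc k B]
      simp
      ring
  have hmem : ∀ (c : M) (g : N[X]), (algebraMap M (Module.End N U) c) (AdjoinRoot.mk f g) =
      AdjoinRoot.mk f (C (algebraMap M N c) * g) := by
    intro c g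
    rw [Module.algebraMap_end_apply, map_mul, AdjoinRoot.mk_C, ← algebraMap_smul N c,
      Algebra.smul_def]
    rfl
  have hrel := hE.exists_algHom (R := Module.End N U) (x := x) (y := y) ?_ ?_ ?_
  · exact hrel.elim fun ρ => HasRep.of_end hU ρ
  · refine LinearMap.ext fun u => ?_
    obtain ⟨g, rfl⟩ := AdjoinRoot.mk_surjective u
    rw [LinearMap.sub_apply, hxpow, hxm, hmem, ← map_sub, AdjoinRoot.mk_eq_mk]
    exact ⟨g, by rw [hf, asPoly]; ring⟩
  · refine LinearMap.ext fun u => ?_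
    obtain ⟨g, rfl⟩ := AdjoinRoot.mk_surjective u
    rw [hypow, hmem, AdjoinRoot.mk_eq_mk]
    obtain ⟨Q, hQ⟩ := hB
    refine ⟨Q * g, ?_⟩
    rw [CharP.cast_eq_zero, ← mul_assoc, ← hQ]
    simp
    ring
  · refine LinearMap.ext fun u => ?_
    obtain ⟨g, rfl⟩ := AdjoinRoot.mk_surjective u
    change y (x _) = x (y _) - y _
    rw [hxm, hym, hym, hxm, ← map_sub]
    congr 1
    simp
    ring

/-- A split cyclic algebra solves the norm equation. -/
theorem IsCyclicAlgWith.exists_normEq_of_hasRep {E : Type} [Ring E] [Algebra M E] {a b : M}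
    (hE : IsCyclicAlgWith p M E a b) (hrep : HasRep M E N p) :
    ∃ B : N[X], NormEq p (algebraMap M N a) (algebraMap M N b) B := by
  by_cases hr : ∃ r : N, r ^ p - r = algebraMap M N a
  · obtain ⟨r, hr⟩ := hr
    exact exists_normEq_of_root hr _
  push Not at hr
  have hirr := asPoly_irreducible hr
  obtain ⟨-, -, i, j, hi, hj, hij, -⟩ := hE
  obtain ⟨ρ₀⟩ := hrep
  let U := Fin p → N
  let ρ : E →ₐ[M] Module.End N U :=
    ((Matrix.toLinAlgEquiv' (R := N)).toAlgHom.restrictScalars M).comp ρ₀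
  set x := ρ i with hxdef
  set y := ρ j with hydef
  have halg : ∀ c : M, ρ (algebraMap M E c) = algebraMap N (Module.End N U) (algebraMap M N c) := by
    intro c
    rw [AlgHom.commutes, IsScalarTower.algebraMap_apply M N (Module.End N U)]
  have hx : x ^ p - x = algebraMap N (Module.End N U) (algebraMap M N a) := by
    rw [hxdef, ← map_pow, ← map_sub, hi, halg]
  have hy : y ^ p = algebraMap N (Module.End N U) (algebraMap M N b) := by
    rw [hydef, ← map_pow, hj, halg]
  have hxy : y * x = (x - 1) * y := by
    rw [hxdef, hydef, ← map_mul, hij, map_mul, map_sub, map_one]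
  have : Nonempty (Fin p) := ⟨⟨0, hp.out.pos⟩⟩
  obtain ⟨u, hu⟩ := exists_ne (0 : U)
  have hker : ∀ g : N[X], aeval x g u = 0 → asPoly p (algebraMap M N a) ∣ g := by
    intro g hg
    by_contra hnd
    obtain ⟨s, t, hst⟩ := (hirr.coprime_iff_not_dvd.mpr hnd)
    apply hu
    have h0 : aeval x (asPoly p (algebraMap M N a)) = 0 := by simp [asPoly, hx]
    have := congrArg (fun g => aeval x g u) hst
    simpa [h0, hg] using this.symm
  let φ : degreeLT N p →ₗ[N] U :=
    ((LinearMap.applyₗ u).comp (aeval x).toLinearMap).comp (degreeLT N p).subtype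
  have hφ : Function.Injective φ := by
    rw [injective_iff_map_eq_zero]
    rintro ⟨g, hg⟩ hgu
    have hdvd := hker g hgu
    rw [mem_degreeLT] at hg
    refine Subtype.ext (eq_zero_of_dvd_of_degree_lt hdvd ?_)
    rwa [degree_eq_natDegree (asPoly_monic _).ne_zero, asPoly_natDegree]
  have hfin : FiniteDimensional N (degreeLT N p) := FiniteDimensional.of_injective φ hφ
  have hsurj : Function.Surjective φ :=
    (LinearMap.injective_iff_surjective_of_finrank_eq_finrank (by
      rw [(degreeLTEquiv N p).finrank_eq])).mp hφ
  obtain ⟨⟨B, hBdeg⟩, hB⟩ := hsurj (y u)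
  have hB' : aeval x B u = y u := hB
  refine ⟨B, hker _ ?_⟩
  have hpow : ∀ t : ℕ, (y ^ t) u = aeval x (∏ k ∈ Finset.range t, B.comp (X - C (k : N))) u := by
    intro t
    induction t with
    | zero => simp
    | succ t ih =>
      rw [pow_succ', Module.End.mul_apply, ih, ← Module.End.mul_apply, mul_aeval_of_shift hxy,
        Module.End.mul_apply, ← hB', ← Module.End.mul_apply, ← map_mul, Finset.prod_range_succ']
      congr 2
      rw [prod_comp]
      congr 1
      · refine Finset.prod_congr rfl fun k _ => ?_
        rw [comp_assoc]
        congr 1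
        simp
        ring
      · simp
  rw [map_sub, LinearMap.sub_apply, ← hpow, hy]
  simp

end Cyclic

section Extraction

variable {p : ℕ} [hp : Fact p.Prime] {F : Type} [Field F] [CharP F p] {Ω : Type} [Field Ω]
  [Algebra F Ω]

/-- Over a field `K` with `K ^ p ⊆ F`, `p`-cyclic reducibility describes the splitting of `A` over
extensions of a compositum `L K` by a norm equation. -/
theorem IsPCyclicReducible.exists_norm_criterion [IsAlgClosed Ω] [Algebra.IsAlgebraic F Ω]
    (hred : IsPCyclicReducible p F) {A : Type} [Ring A] [Algebra F A] (hA : IsCSA F A)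
    (hexp : HasExponent F A p) {q : ℕ} (hq : finrank F A = q ^ 2) (K : IntermediateField F Ω)
    (hK : ∀ z ∈ K, z ^ p ∈ (algebraMap F Ω).range) :
    IsSplitAlg K (K ⊗[F] A) ∨ ∃ d : ℕ, 0 < d ∧ HasIndex K (K ⊗[F] A) (p * d) ∧
      ∃ L : IntermediateField F Ω, Algebra.IsSeparable F L ∧ finrank F L = d ∧
        ∃ r b : Ω, r ^ p - r ∈ L ⊔ K ∧ b ∈ L ⊔ K ∧ b ≠ 0 ∧
          ∀ N : IntermediateField F Ω, L ⊔ K ≤ N → (HasRep F A N q ↔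
            ∃ B : N[X], ∏ k ∈ Finset.range p, aeval (r - (k : Ω)) B = b) := by
  have hchar : CharP Ω p := charP_of_injective_algebraMap (algebraMap F Ω).injective p
  have hKp : ∀ z : K, z ^ p ∈ (algebraMap F K).range := by
    intro z
    obtain ⟨c, hc⟩ := hK z z.2
    exact ⟨c, Subtype.ext hc⟩
  have hexpF : ExpChar F p := ExpChar.prime hp.out
  have hpi : IsPurelyInseparable F K :=
    (isPurelyInseparable_iff_pow_mem F p).mpr fun z => ⟨1, by simpa using hKp z⟩
  rcases hred A hA hexp K hpi hKp with h | ⟨d, hd, L, _, _, hsep, hLd, M, _, _, _, _, _, _, hM, E,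
    _, _, ⟨a, b, hE⟩, hBr⟩
  · exact Or.inl h
  refine Or.inr ⟨d, ?_, hd, ?_⟩
  · rcases Nat.eq_zero_or_pos d with rfl | h
    · obtain ⟨D, _, _, m, hm, -, hD, hmq⟩ := hd.mul_eq_of_finrank (q := q)
        (by rw [Module.finrank_baseChange, hq])
      have := hA.2.2
      have := hA.2.1
      have hpos : 0 < finrank F A := Module.finrank_pos
      rw [hq, ← hmq] at hpos
      simp at hpos
    · exact h
  have hMtop : ∀ S : Subalgebra F M, (∀ l : L, algebraMap L M l ∈ S) →
      (∀ z : K, algebraMap K M z ∈ S) → ∀ z : M, z ∈ S := by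
    intro S h1 h2 z
    have : (⊤ : Subalgebra F M) ≤ S := by
      rw [← hM]
      refine sup_le ?_ ?_
      · rintro _ ⟨l, rfl⟩; exact h1 l
      · rintro _ ⟨l, rfl⟩; exact h2 l
    exact this trivial
  have halg : Algebra.IsAlgebraic F M := by
    refine ⟨fun z => mem_algebraicClosure_iff.mp (hMtop (algebraicClosure F M).toSubalgebra
      (fun l => ?_) (fun z => ?_) z)⟩
    · exact mem_algebraicClosure_iff.mpr (Algebra.IsAlgebraic.isAlgebraic l).algebraMap
    · exact mem_algebraicClosure_iff.mpr (Algebra.IsAlgebraic.isAlgebraic z).algebraMap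
  have halgK : Algebra.IsAlgebraic K M := Algebra.IsAlgebraic.tower_top (K := F) K
  let φ : M →ₐ[K] Ω := IsAlgClosed.lift
  let ψ : L →ₐ[F] Ω := (φ.restrictScalars F).comp (IsScalarTower.toAlgHom F L M)
  have hLe : L ≃ₐ[F] ψ.fieldRange := AlgEquiv.ofInjectiveField ψ
  have hφ : ∀ z : M, φ z ∈ ψ.fieldRange ⊔ K := by
    refine hMtop ((ψ.fieldRange ⊔ K).toSubalgebra.comap (φ.restrictScalars F)) (fun l => ?_)
      fun z => ?_
    · exact (le_sup_left : ψ.fieldRange ≤ ψ.fieldRange ⊔ K) ⟨l, rfl⟩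
    · change φ (algebraMap K M z) ∈ ψ.fieldRange ⊔ K
      rw [φ.commutes]
      exact (le_sup_right : K ≤ ψ.fieldRange ⊔ K) z.2
  obtain ⟨r, hr⟩ := IsAlgClosed.exists_root (asPoly p (φ a)) (by
    rw [degree_eq_natDegree (asPoly_monic _).ne_zero, asPoly_natDegree]
    exact_mod_cast hp.out.ne_zero)
  have hr' : r ^ p - r = φ a := by
    rw [IsRoot, asPoly, eval_sub, eval_sub, eval_pow, eval_X, eval_C, sub_eq_zero] at hr
    exact hr
  refine ⟨ψ.fieldRange, Algebra.IsSeparable.of_algHom F L hLe.symm.toAlgHom,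
    by rw [← hLd, hLe.toLinearEquiv.finrank_eq], r, φ b, hr' ▸ hφ a, hφ b, ?_, ?_⟩
  · simpa using hE.1
  intro N hN
  let g : M →ₐ[F] N := (φ.restrictScalars F).codRestrict N.toSubalgebra fun z => hN (hφ z)
  let algMN : Algebra M N := g.toRingHom.toAlgebra
  have hst : IsScalarTower F M N := IsScalarTower.of_algebraMap_eq fun c => (g.commutes c).symm
  have hcharN : CharP N p := charP_of_injective_algebraMap (algebraMap F N).injective p
  have hMA : finrank M (M ⊗[F] A) = q ^ 2 := by rw [Module.finrank_baseChange, hq]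
  have hnorm : ∀ B : N[X], NormEq p (algebraMap M N a) (algebraMap M N b) B ↔
      ∏ k ∈ Finset.range p, aeval (r - (k : Ω)) B = φ b := fun B => normEq_iff hr'
  rw [← hasRep_baseChange_iff (M := M)]
  constructor
  · intro h
    obtain ⟨B, hB⟩ := hE.exists_normEq_of_hasRep (h.of_brauerEquiv hBr hMA hE.2.1)
    exact ⟨B, (hnorm B).mp hB⟩
  · rintro ⟨B, hB⟩
    exact (hE.hasRep_of_normEq ((hnorm B).mpr hB)).of_brauerEquiv hBr.symm' hE.2.1 hMA

end Extraction

section Descent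

theorem isSeparable_of_derivative_ne_zero {E Ω : Type} [Field E] [Field Ω] [Algebra E Ω] {g : E[X]}
    {β : Ω} (h0 : aeval β g = 0) (h1 : aeval β (derivative g) ≠ 0) : IsSeparable E β := by
  have hg : g ≠ 0 := by rintro rfl; simp at h1
  have hintegral : IsIntegral E β := isAlgebraic_iff_isIntegral.mp ⟨g, hg, h0⟩
  rw [IsSeparable, separable_iff_derivative_ne_zero (minpoly.irreducible hintegral)]
  intro h
  obtain ⟨u, rfl⟩ := minpoly.dvd E β h0
  simp [derivative_mul, h] at h1

theorem isSeparable_of_prod_linear {E Ω : Type} [Field E] [Field Ω] [Algebra E Ω] {p : ℕ}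
    {c u : ℕ → E} {b : E} {β : Ω} (hb : b ≠ 0)
    (h0 : ∏ k ∈ Finset.range p, (algebraMap E Ω (c k) + algebraMap E Ω (u k) * β) =
      algebraMap E Ω b)
    (h1 : ∑ k ∈ Finset.range p,
      algebraMap E Ω (u k) / (algebraMap E Ω (c k) + algebraMap E Ω (u k) * β) ≠ 0) :
    IsSeparable E β := by
  have hb' : algebraMap E Ω b ≠ 0 := by simpa using hb
  refine isSeparable_of_derivative_ne_zero
    (g := ∏ k ∈ Finset.range p, (C (c k) + C (u k) * X) - C b) ?_ ?_
  · simp [map_prod, h0]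
  · rw [derivative_sub, derivative_C, sub_zero, derivative_prod_finset, map_sum]
    have hne : ∀ k ∈ Finset.range p, algebraMap E Ω (c k) + algebraMap E Ω (u k) * β ≠ 0 :=
      Finset.prod_ne_zero_iff.mp (h0 ▸ hb')
    have : ∀ k ∈ Finset.range p, aeval β ((∏ j ∈ (Finset.range p).erase k, (C (c j) + C (u j) * X)) *
        derivative (C (c k) + C (u k) * X)) = algebraMap E Ω b *
          (algebraMap E Ω (u k) / (algebraMap E Ω (c k) + algebraMap E Ω (u k) * β)) := by
      intro k hk
      rw [← h0, ← Finset.prod_erase_mul _ _ hk, ← mul_div_assoc, eq_div_iff (hne k hk)]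
      simp [map_prod]
      ring
    rw [Finset.sum_congr rfl this, ← Finset.mul_sum]
    exact mul_ne_zero hb' h1

variable {p : ℕ} [hp : Fact p.Prime] {F Ω : Type} [Field F] [CharP F p] [Field Ω] [Algebra F Ω]

theorem mem_range_of_isSeparable_of_pow_mem {x : Ω} (hx : IsSeparable F x)
    (hxp : x ^ p ∈ (algebraMap F Ω).range) : x ∈ (algebraMap F Ω).range := by
  have hexpF : ExpChar F p := ExpChar.prime hp.out
  have : x ∈ separableClosure F Ω ⊓ perfectClosure F Ω :=
    ⟨mem_separableClosure_iff.mpr hx,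
      (mem_perfectClosure_iff_pow_mem p).mpr ⟨1, by simpa using hxp⟩⟩
  rw [separableClosure_inf_perfectClosure] at this
  exact IntermediateField.mem_bot.mp this

variable (p F Ω) in
/-- The field of `p`-th roots of elements of `F` in `Ω`. -/
def pthRoots : IntermediateField F Ω :=
  have : CharP Ω p := charP_of_injective_algebraMap (algebraMap F Ω).injective p
  ((algebraMap F Ω).fieldRange.comap (frobenius Ω p)).toIntermediateField
    fun c => ⟨c ^ p, map_pow _ _ _⟩

theorem mem_pthRoots {x : Ω} : x ∈ pthRoots p F Ω ↔ x ^ p ∈ (algebraMap F Ω).range := Iff.rfl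

theorem finrank_sup_adjoin_le (K : IntermediateField F Ω) [FiniteDimensional F K] (T : Finset Ω)
    (hT : ∀ x ∈ T, x ∈ pthRoots p F Ω) :
    FiniteDimensional F ↥(K ⊔ IntermediateField.adjoin F (T : Set Ω)) ∧
      finrank F ↥(K ⊔ IntermediateField.adjoin F (T : Set Ω)) ≤ finrank F K * p ^ T.card := by
  classical
  induction T using Finset.induction_on with
  | empty =>
    rw [Finset.coe_empty, IntermediateField.adjoin_empty, sup_bot_eq]
    exact ⟨inferInstance, by simp⟩
  | insert x T hx ih =>
    obtain ⟨h1, h2⟩ := ih fun y hy => hT y (Finset.mem_insert_of_mem hy)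
    obtain ⟨c, hc⟩ := mem_pthRoots.mp (hT x (Finset.mem_insert_self x T))
    have h0 : aeval x (X ^ p - C c) = 0 := by simp [hc]
    have hne : (X ^ p - C c : F[X]) ≠ 0 := X_pow_sub_C_ne_zero hp.out.pos c
    have hintegral : IsIntegral F x := isAlgebraic_iff_isIntegral.mp ⟨_, hne, h0⟩
    have hle : finrank F (IntermediateField.adjoin F {x}) ≤ p := by
      rw [IntermediateField.adjoin.finrank hintegral]
      refine (natDegree_le_of_dvd (minpoly.dvd F x h0) hne).trans_eq ?_
      exact natDegree_X_pow_sub_C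
    have h3 : FiniteDimensional F (IntermediateField.adjoin F {x}) :=
      IntermediateField.adjoin.finiteDimensional hintegral
    have heq : K ⊔ IntermediateField.adjoin F ((insert x T : Finset Ω) : Set Ω) =
        (K ⊔ IntermediateField.adjoin F (T : Set Ω)) ⊔ IntermediateField.adjoin F {x} := by
      rw [Finset.coe_insert, Set.insert_eq, IntermediateField.adjoin_union, sup_assoc,
        sup_comm (IntermediateField.adjoin F {x})]
    rw [heq]
    refine ⟨IntermediateField.finiteDimensional_sup _ _,
      (IntermediateField.finrank_sup_le _ _).trans ?_⟩
    rw [Finset.card_insert_of_notMem hx, pow_succ, ← mul_assoc]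
    exact Nat.mul_le_mul h2 hle

theorem exists_coeffs_of_mem_sup {L k : IntermediateField F Ω} [FiniteDimensional F L] {d : ℕ}
    (e : Basis (Fin d) F L) {β : Ω} (hβ : β ∈ L ⊔ k) :
    ∃ κ : Fin d → Ω, (∀ j, κ j ∈ k) ∧ β = ∑ j, (e j : Ω) * κ j := by
  have h : β ∈ Subalgebra.toSubmodule L.toSubalgebra * Subalgebra.toSubmodule k.toSubalgebra := by
    rw [Subalgebra.mul_toSubmodule, ← IntermediateField.sup_toSubalgebra_of_left]
    exact hβ
  induction h using Submodule.mul_induction_on' with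
  | mem_mul_mem l hl c hc =>
    refine ⟨fun j => algebraMap F Ω (e.repr ⟨l, hl⟩ j) * c, fun j =>
      k.mul_mem (k.algebraMap_mem _) hc, ?_⟩
    have := congrArg (fun z : L => (z : Ω)) (e.sum_repr ⟨l, hl⟩)
    simp only [IntermediateField.coe_sum, IntermediateField.coe_smul] at this
    conv_lhs => rw [← this]
    rw [Finset.sum_mul]
    refine Finset.sum_congr rfl fun j _ => ?_
    rw [Algebra.smul_def]
    ring
  | add x hx y hy ihx ihy =>
    have hle : ∀ z ∈ Subalgebra.toSubmodule L.toSubalgebra * Subalgebra.toSubmodule k.toSubalgebra,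
        z ∈ L ⊔ k := by
      intro z hz
      rw [Subalgebra.mul_toSubmodule, ← IntermediateField.sup_toSubalgebra_of_left] at hz
      exact hz
    obtain ⟨κ, hκ, rfl⟩ := ihx (hle x hx)
    obtain ⟨κ', hκ', rfl⟩ := ihy (hle y hy)
    exact ⟨κ + κ', fun j => k.add_mem (hκ j) (hκ' j), by
      simp [mul_add, Finset.sum_add_distrib]⟩

/-- Enlarge `K` by the coefficients of a solution of a norm equation over `L K ^ (1 / p)`, all but
one: the last one is then separable over, hence already contained in, the compositum with `L`. -/
theorem exists_norm_descent {K L : IntermediateField F Ω} [FiniteDimensional F K]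
    [FiniteDimensional F L] (hK : K ≤ pthRoots p F Ω) {r b : Ω} (hr : r ^ p - r ∈ L ⊔ K)
    (hb : b ∈ L ⊔ K) (hb0 : b ≠ 0) {N : IntermediateField F Ω}
    (hN : N = L ⊔ pthRoots p F Ω) (B : N[X])
    (hB : ∏ k ∈ Finset.range p, aeval (r - (k : Ω)) B = b) :
    ∃ K' : IntermediateField F Ω, K ≤ K' ∧ K' ≤ pthRoots p F Ω ∧ FiniteDimensional F K' ∧
      finrank F K' ≤ finrank F K * p ^ ((p - 1) * finrank F L) ∧
      ∃ B' : (L ⊔ K' : IntermediateField F Ω)[X],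
        ∏ k ∈ Finset.range p, aeval (r - (k : Ω)) B' = b := by
  classical
  have hchar : CharP Ω p := charP_of_injective_algebraMap (algebraMap F Ω).injective p
  let a : N := ⟨r ^ p - r, hN ▸ sup_le_sup_left hK L hr⟩
  obtain ⟨β, hβN, hβ⟩ : ∃ β : Fin p → Ω, (∀ l, β l ∈ N) ∧
      ∀ k : ℕ, aeval (r - (k : Ω)) B = ∑ l, β l * (r - (k : Ω)) ^ (l : ℕ) := by
    refine ⟨fun l => (B %ₘ asPoly p a).coeff l, fun l => Subtype.prop _, fun k => ?_⟩
    have h0 : aeval (r - (k : Ω)) (asPoly p a) = 0 := by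
      have hk : (k : Ω) ^ p = k := map_natCast (frobenius Ω p) k
      have ha : algebraMap N Ω a = r ^ p - r := rfl
      simp only [asPoly, map_sub, map_pow, aeval_X, aeval_C, ha]
      rw [sub_pow_char, hk]
      ring
    have hdeg : (B %ₘ asPoly p a).natDegree < p := by
      have := natDegree_modByMonic_lt B (asPoly_monic (p := p) a) (by
        intro h
        have := asPoly_natDegree (p := p) a
        rw [h, natDegree_one] at this
        exact hp.out.ne_zero this.symm)
      rwa [asPoly_natDegree] at this
    conv_lhs => rw [← modByMonic_add_div B (asPoly p a), map_add, map_mul, h0, zero_mul, add_zero]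
    rw [aeval_eq_sum_range' hdeg, Finset.sum_range]
    rfl
  rw [Finset.prod_congr rfl fun k _ => hβ k] at hB
  have hv0 : ∀ k ∈ Finset.range p, ∑ l, β l * (r - (k : Ω)) ^ (l : ℕ) ≠ 0 :=
    Finset.prod_ne_zero_iff.mp (hB ▸ hb0)
  obtain ⟨s, hs⟩ : ∃ s : Fin p, ∑ k : Fin p,
      (∑ l, β l * (r - ((k : ℕ) : Ω)) ^ (l : ℕ))⁻¹ * (r - ((k : ℕ) : Ω)) ^ (s : ℕ) ≠ 0 := by
    by_contra! h
    have hinj : Function.Injective fun k : Fin p => r - ((k : ℕ) : Ω) := fun i j hij =>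
      Fin.ext (natCast_injOn_range r (Finset.mem_coe.mpr (Finset.mem_range.mpr i.2))
        (Finset.mem_coe.mpr (Finset.mem_range.mpr j.2)) hij)
    have := congrFun (Matrix.eq_zero_of_forall_pow_sum_mul_pow_eq_zero hinj h) ⟨0, hp.out.pos⟩
    exact hv0 0 (Finset.mem_range.mpr hp.out.pos) (inv_eq_zero.mp this)
  let e := finBasis F L
  choose κ hκ hκβ using fun l => exists_coeffs_of_mem_sup e (hN ▸ hβN l)
  let T : Finset Ω := ((Finset.univ.erase s) ×ˢ Finset.univ).image fun lj => κ lj.1 lj.2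
  have hT : ∀ x ∈ T, x ∈ pthRoots p F Ω := by
    intro x hx
    obtain ⟨lj, -, rfl⟩ := Finset.mem_image.mp hx
    exact hκ _ _
  obtain ⟨hfin, hdim⟩ := finrank_sup_adjoin_le K T hT
  set K' := K ⊔ IntermediateField.adjoin F (T : Set Ω) with hK'
  refine ⟨K', le_sup_left, sup_le hK (IntermediateField.adjoin_le_iff.mpr hT), hfin, ?_, ?_⟩
  · refine hdim.trans (Nat.mul_le_mul_left _ (Nat.pow_le_pow_right hp.out.pos ?_))
    refine Finset.card_image_le.trans_eq ?_
    rw [Finset.card_product, Finset.card_erase_of_mem (Finset.mem_univ s)]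
    simp
  have hle : L ⊔ K ≤ L ⊔ K' := sup_le_sup_left le_sup_left L
  set M := L ⊔ K' with hM
  have hcharM : CharP M p := charP_of_injective_algebraMap (algebraMap F M).injective p
  have heM : ∀ j, (e j : Ω) ∈ M := fun j => (le_sup_left : L ≤ M) (e j).2
  have hβM : ∀ l, l ≠ s → β l ∈ M := by
    intro l hl
    rw [hκβ l]
    refine M.sum_mem fun j _ => M.mul_mem (heM j) ?_
    refine (le_sup_right : K' ≤ M) ((le_sup_right : _ ≤ K') (IntermediateField.subset_adjoin F _ ?_))
    exact Finset.mem_coe.mpr (Finset.mem_image.mpr ⟨(l, j), by simp [hl], rfl⟩)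
  have hβs : β s ^ p ∈ M := by
    rw [hκβ s, sum_pow_char]
    refine M.sum_mem fun j _ => ?_
    rw [mul_pow]
    obtain ⟨c, hc⟩ := mem_pthRoots.mp (hκ s j)
    rw [← hc]
    exact M.mul_mem (pow_mem (heM j) p) (M.algebraMap_mem c)
  have hrsep : IsSeparable M r := by
    refine isSeparable_of_derivative_ne_zero (g := asPoly p ⟨r ^ p - r, hle hr⟩) ?_ ?_
    · have ha : algebraMap M Ω ⟨r ^ p - r, hle hr⟩ = r ^ p - r := rfl
      simp [asPoly, ha]
    · simp [asPoly, derivative_X_pow]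
  let E := IntermediateField.adjoin M {r}
  have hEsep : Algebra.IsSeparable M E :=
    (IntermediateField.isSeparable_adjoin_simple_iff_isSeparable _ _).mpr hrsep
  have hrE : ∀ k : ℕ, r - (k : Ω) ∈ E := fun k =>
    E.sub_mem (IntermediateField.mem_adjoin_simple_self M r) (natCast_mem E k)
  have hME : ∀ x ∈ M, x ∈ E := fun x hx => E.algebraMap_mem ⟨x, hx⟩
  have hsplit : ∀ k : ℕ, ∑ l, β l * (r - (k : Ω)) ^ (l : ℕ) =
      ∑ l ∈ Finset.univ.erase s, β l * (r - (k : Ω)) ^ (l : ℕ) + (r - (k : Ω)) ^ (s : ℕ) * β s := by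
    intro k
    rw [← Finset.sum_erase_add _ _ (Finset.mem_univ s), mul_comm (β s)]
  have hβsep : IsSeparable E (β s) := by
    refine isSeparable_of_prod_linear (p := p)
      (c := fun k => ⟨∑ l ∈ Finset.univ.erase s, β l * (r - (k : Ω)) ^ (l : ℕ),
        E.sum_mem fun l hl => E.mul_mem (hME _ (hβM l (Finset.ne_of_mem_erase hl)))
          (pow_mem (hrE k) _)⟩)
      (u := fun k => ⟨(r - (k : Ω)) ^ (s : ℕ), pow_mem (hrE k) _⟩)
      (b := ⟨b, hME _ (hle hb)⟩) (fun h => hb0 (congrArg Subtype.val h)) ?_ ?_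
    · simp only [hsplit] at hB
      exact hB
    · simp only [hsplit] at hs
      rw [Finset.sum_range]
      convert hs using 2 with k
      rw [inv_mul_eq_div]
      rfl
  have hβsM : β s ∈ M := by
    obtain ⟨z, hz⟩ := mem_range_of_isSeparable_of_pow_mem (p := p) (F := M)
      (IsSeparable.of_algebra_isSeparable_of_isSeparable M hβsep) ⟨⟨β s ^ p, hβs⟩, rfl⟩
    rw [← hz]
    exact z.2
  have hβM' : ∀ l, β l ∈ M := fun l => if h : l = s then h ▸ hβsM else hβM l h
  refine ⟨∑ l : Fin p, C ⟨β l, hβM' l⟩ * X ^ (l : ℕ), ?_⟩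
  rw [← hB]
  refine Finset.prod_congr rfl fun k _ => ?_
  simp only [map_sum, map_mul, aeval_C, map_pow, aeval_X]
  rfl

theorem exists_norm_descent_bot [IsAlgClosed Ω] {L : IntermediateField F Ω}
    [FiniteDimensional F L] [Algebra.IsSeparable F L] (r : Ω) {b : Ω} (hb : b ∈ L) :
    ∃ K' : IntermediateField F Ω, K' ≤ pthRoots p F Ω ∧ FiniteDimensional F K' ∧
      finrank F K' ≤ p ^ finrank F L ∧
      ∃ B' : (L ⊔ K' : IntermediateField F Ω)[X],
        ∏ k ∈ Finset.range p, aeval (r - (k : Ω)) B' = b := by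
  classical
  have hchar : CharP Ω p := charP_of_injective_algebraMap (algebraMap F Ω).injective p
  have hcharL : CharP L p := charP_of_injective_algebraMap (algebraMap F L).injective p
  have hexpF : ExpChar F p := ExpChar.prime hp.out
  let e := finBasis F L
  let e' := e.mapPowExpCharPowOfIsSeparable p 1
  choose κ hκ using fun j => IsAlgClosed.exists_pow_nat_eq
    (algebraMap F Ω (e'.repr ⟨b, hb⟩ j)) hp.out.pos
  let T : Finset Ω := Finset.univ.image κ
  have hT : ∀ x ∈ T, x ∈ pthRoots p F Ω := by
    intro x hx
    obtain ⟨j, -, rfl⟩ := Finset.mem_image.mp hx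
    exact mem_pthRoots.mpr ⟨_, (hκ j).symm⟩
  obtain ⟨hfin, hdim⟩ := finrank_sup_adjoin_le ⊥ T hT
  rw [bot_sup_eq] at hfin hdim
  refine ⟨IntermediateField.adjoin F (T : Set Ω), IntermediateField.adjoin_le_iff.mpr hT, hfin,
    ?_, ?_⟩
  · rw [IntermediateField.finrank_bot, one_mul] at hdim
    refine hdim.trans (Nat.pow_le_pow_right hp.out.pos (Finset.card_image_le.trans_eq ?_))
    simp
  set M := L ⊔ IntermediateField.adjoin F (T : Set Ω) with hM
  have hθ : ∑ j, (e j : Ω) * κ j ∈ M := by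
    refine M.sum_mem fun j _ => M.mul_mem ((le_sup_left : L ≤ M) (e j).2) ?_
    exact (le_sup_right : _ ≤ M) (IntermediateField.subset_adjoin F _
      (Finset.mem_coe.mpr (Finset.mem_image_of_mem _ (Finset.mem_univ j))))
  refine ⟨C ⟨_, hθ⟩, ?_⟩
  have h1 := congrArg (fun z : L => (z : Ω)) (e'.sum_repr ⟨b, hb⟩)
  simp only [IntermediateField.coe_sum, IntermediateField.coe_smul] at h1
  have h2 : algebraMap M Ω ⟨_, hθ⟩ = ∑ j, (e j : Ω) * κ j := rfl
  simp only [aeval_C, Finset.prod_const, Finset.card_range, h2]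
  rw [sum_pow_char, ← h1]
  refine Finset.sum_congr rfl fun j _ => ?_
  rw [mul_pow, hκ, Algebra.smul_def, mul_comm]
  congr 1
  simp [e', Basis.mapPowExpCharPowOfIsSeparable]

end Descent

section CyclicShift

variable {p q : ℕ} [NeZero p] {S : Type*} [Field S]

/-- The cyclic shift by `j` on functions of `p`-tuples. -/
def cyclicShift (S : Type*) [Field S] (p q : ℕ) [NeZero p] (j : Fin p) :
    ((Fin p → Fin q) → S) →ₗ[S] ((Fin p → Fin q) → S) :=
  LinearMap.funLeft S S fun x k => x (k + j)

lemma cyclicShift_apply (j : Fin p) (f : (Fin p → Fin q) → S) (x : Fin p → Fin q) :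
    cyclicShift S p q j f x = f fun k => x (k + j) := rfl

lemma cyclicShift_pow_apply (j : Fin p) (n : ℕ) (f : (Fin p → Fin q) → S) (x : Fin p → Fin q) :
    (cyclicShift S p q j ^ n) f x = f fun k => x (k + n • j) := by
  induction n generalizing x with
  | zero => simp
  | succ n ih =>
    rw [pow_succ', Module.End.mul_apply, cyclicShift_apply, ih]
    congr 1
    funext k
    rw [succ_nsmul, add_assoc]

lemma cyclicShift_pow_self (j : Fin p) : cyclicShift S p q j ^ p = 1 := by
  ext1
  ext f
  have h : p • j = 0 := by simpa using card_nsmul_eq_zero' (x := j)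
  simp [cyclicShift_pow_apply, h]

/-- Over a field of characteristic `p`, a cyclically invariant function on `p`-tuples which
vanishes on constant tuples is a trace. -/
lemma exists_sum_cyclicShift_eq [Fact p.Prime] [CharP S p] {f : (Fin p → Fin q) → S}
    (hf : ∀ j, cyclicShift S p q j f = f) (h0 : ∀ i, f (fun _ => i) = 0) :
    ∃ g, ∑ j, cyclicShift S p q j g = f := by
  classical
  let m : (Fin p → Fin q) → Fin q := fun x => Finset.univ.inf' ⟨0, Finset.mem_univ 0⟩ x
  let c : (Fin p → Fin q) → ℕ := fun x => (Finset.univ.filter fun k => x k = m x).card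
  have hm : ∀ x (j : Fin p), m (fun k => x (k + j)) = m x := by
    intro x j
    apply le_antisymm
    · refine Finset.le_inf' _ _ fun k _ => ?_
      have := Finset.inf'_le (s := Finset.univ) (fun k => x (k + j)) (Finset.mem_univ (k - j))
      simpa using this
    · exact Finset.le_inf' _ _ fun k _ => Finset.inf'_le _ (Finset.mem_univ _)
  have hc : ∀ x (j : Fin p), c (fun k => x (k + j)) = c x := by
    intro x j
    simp only [c, hm]
    refine Finset.card_bij (fun k _ => k + j) ?_ ?_ ?_
    · intro k hk; simpa using hk
    · intro a _ b _ h; exact add_right_cancel h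
    · intro k hk
      exact ⟨k - j, by simpa using hk, by simp⟩
  refine ⟨fun x => if x 0 = m x then (c x : S)⁻¹ * f x else 0, ?_⟩
  ext x
  have hinv : ∀ j, f (fun k => x (k + j)) = f x := fun j => congrFun (hf j) x
  simp only [Finset.sum_apply, cyclicShift_apply, hm, hc, hinv, zero_add]
  rw [← Finset.sum_filter, Finset.sum_const, nsmul_eq_mul, ← mul_assoc]
  by_cases hx : ∀ k, x k = m x
  · have : x = fun _ => m x := funext hx
    have hz : f x = 0 := by rw [this]; exact h0 _
    rw [hz, mul_zero]
  · push Not at hx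
    obtain ⟨k, hk⟩ := hx
    have hpos : 0 < c x := by
      obtain ⟨l, -, hl⟩ := Finset.exists_mem_eq_inf' (s := Finset.univ) ⟨0, Finset.mem_univ 0⟩ x
      exact Finset.card_pos.2 ⟨l, by simpa using hl.symm⟩
    have hlt : c x < p := by
      have : c x < Finset.univ.card :=
        Finset.card_lt_card (Finset.filter_ssubset.2 ⟨k, Finset.mem_univ _, hk⟩)
      simpa using this
    have hne : (c x : S) ≠ 0 := by
      rw [Ne, CharP.cast_eq_zero_iff S p]
      exact Nat.not_dvd_of_pos_of_lt hpos hlt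
    change (c x : S) * (c x : S)⁻¹ * f x = f x
    rw [mul_inv_cancel₀ hne, one_mul]

lemma sum_cyclicShift_const [CharP S p] (g : (Fin p → Fin q) → S) (i : Fin q) :
    (∑ j, cyclicShift S p q j g) (fun _ => i) = 0 := by
  simp [cyclicShift_apply]

/-- The sum over all points of a cyclically invariant function is the sum over constant tuples. -/
lemma sum_eq_sum_const [Fact p.Prime] [CharP S p] {f : (Fin p → Fin q) → S}
    (hf : ∀ j, cyclicShift S p q j f = f) : ∑ x, f x = ∑ i, f fun _ => i := by
  classical
  let e : (Fin p → Fin q) → S := fun x => if ∀ k, x k = x 0 then f x else 0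
  have he : ∀ j, cyclicShift S p q j e = e := by
    intro j
    ext x
    have h : (∀ k, x (k + j) = x (0 + j)) ↔ ∀ k, x k = x 0 := by
      constructor
      · intro h k
        have h1 := h (k - j)
        have h2 := h (0 - j)
        rw [sub_add_cancel] at h1 h2
        rw [h1, h2]
      · intro h k
        rw [h, h (0 + j)]
    have := congrFun (hf j) x
    rw [cyclicShift_apply] at this
    simp only [cyclicShift_apply, e, h, this]
  obtain ⟨g, hg⟩ := exists_sum_cyclicShift_eq (f := f - e)
    (fun j => by rw [map_sub, hf, he]) (fun i => by simp [e])
  have hsum : ∑ x, (f - e) x = 0 := by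
    rw [← hg]
    simp only [Finset.sum_apply]
    rw [Finset.sum_comm]
    have : ∀ j : Fin p, ∑ x, cyclicShift S p q j g x = ∑ x, g x := fun j =>
      ((Equiv.addRight j).symm.arrowCongr (Equiv.refl (Fin q))).sum_comp g
    simp [this]
  have h2 : ∑ x, e x = ∑ i, f fun _ => i := by
    simp only [e]
    rw [← Finset.sum_filter]
    symm
    refine Finset.sum_bij (fun i _ => fun _ => i) ?_ ?_ ?_ ?_
    · intro i _; simp
    · intro i _ i' _ h; exact congrFun h 0
    · intro x hx
      exact ⟨x 0, Finset.mem_univ _, funext fun k => ((Finset.mem_filter.1 hx).2 k).symm⟩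
    · intro i _; rfl
  rw [← h2, ← sub_eq_zero, ← Finset.sum_sub_distrib]
  exact hsum

end CyclicShift

section Descent

variable {F S : Type} [Field F] [Field S] [Algebra F S]

/-- Every representation of a matrix algebra over an extension field which has the dimension of
the standard one is isomorphic to it. -/
lemma exists_intertwiner {N : ℕ} {X : Type*} [Fintype X] [DecidableEq X] (hN : 0 < N)
    (hX : Fintype.card X = N) (Ψ : Matrix (Fin N) (Fin N) F →ₐ[F] Matrix X X S) :
    ∃ T : (Fin N → S) ≃ₗ[S] (X → S), ∀ m v,
      T ((m.map (algebraMap F S)).mulVec v) = (Ψ m).mulVec (T v) := by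
  classical
  let z : Fin N := ⟨0, hN⟩
  have hmul : ∀ i j k l : Fin N, Ψ (Matrix.single i j 1) * Ψ (Matrix.single k l 1) =
      if j = k then Ψ (Matrix.single i l 1) else 0 := by
    intro i j k l
    rw [← map_mul]
    split_ifs with h
    · subst h; simp
    · simp [h]
  have hne : Ψ (Matrix.single z z 1) ≠ 0 := by
    intro h0
    have hall : ∀ i, Ψ (Matrix.single i i 1) = 0 := by
      intro i
      have h1 := hmul i z z i
      have h2 := hmul i z z z
      rw [if_pos rfl, h0, mul_zero] at h2
      rw [if_pos rfl, ← h2, zero_mul] at h1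
      exact h1.symm
    have h1 : Ψ 1 = 0 := by
      rw [← Matrix.sum_single_one, map_sum]
      exact Finset.sum_eq_zero fun i _ => hall i
    rw [map_one] at h1
    have : Nonempty X := Fintype.card_pos_iff.1 (hX ▸ hN)
    exact one_ne_zero h1
  obtain ⟨w, hw⟩ : ∃ w, (Ψ (Matrix.single z z 1)).mulVec w ≠ 0 := by
    by_contra! h
    exact hne (Matrix.ext_of_mulVec_single fun i => by rw [h, Matrix.zero_mulVec])
  let T₀ : (Fin N → S) →ₗ[S] (X → S) :=
    Fintype.linearCombination S fun i => (Ψ (Matrix.single i z 1)).mulVec w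
  have hT₀ : ∀ v, T₀ v = ∑ i, v i • (Ψ (Matrix.single i z 1)).mulVec w := fun v => rfl
  have hsingle : ∀ i j v, T₀ (((Matrix.single i j (1 : F)).map (algebraMap F S)).mulVec v) =
      (Ψ (Matrix.single i j 1)).mulVec (T₀ v) := by
    intro i j v
    rw [hT₀, hT₀, Matrix.mulVec_sum]
    simp only [Matrix.mulVec_smul, Matrix.mulVec_mulVec, hmul]
    rw [Finset.sum_eq_single i, Finset.sum_eq_single j]
    · simp [Matrix.single_mulVec, Matrix.map_single]
    · intro b _ hb
      simp [hb.symm]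
    · simp
    · intro b _ hb
      simp [Matrix.single_mulVec, Matrix.map_single, Function.update_of_ne hb]
    · simp
  have hinj : Function.Injective T₀ := by
    rw [← LinearMap.ker_eq_bot, LinearMap.ker_eq_bot']
    intro v hv
    ext j
    have := hsingle z j v
    rw [hv, Matrix.mulVec_zero, hT₀, Finset.sum_eq_single z] at this
    · simp only [Matrix.map_single, map_one, Matrix.single_mulVec, one_mul,
        Function.update_self] at this
      exact (smul_eq_zero.1 this).resolve_right hw
    · intro b _ hb
      simp [Matrix.single_mulVec, Matrix.map_single, Function.update_of_ne hb]
    · simp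
  refine ⟨LinearEquiv.ofInjectiveOfFinrankEq T₀ hinj (by simp [hX]), fun m v => ?_⟩
  change T₀ _ = (Ψ m).mulVec (T₀ v)
  induction m using Matrix.induction_on' with
  | h_zero => simp
  | h_add a b ha hb =>
    rw [Matrix.map_add _ (map_add _), Matrix.add_mulVec, map_add, ha, hb, map_add,
      Matrix.add_mulVec]
  | h_std_basis i j x =>
    have h1 : Matrix.single i j x = x • Matrix.single i j (1 : F) := by simp
    have h2 : (x • Matrix.single i j (1 : F)).map (algebraMap F S) =
        algebraMap F S x • (Matrix.single i j (1 : F)).map (algebraMap F S) := by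
      ext a b
      simp only [Matrix.map_apply, Matrix.smul_apply, smul_eq_mul, map_mul]
    rw [h1, h2, Matrix.smul_mulVec, map_smul, hsingle, map_smul, Matrix.smul_mulVec,
      algebraMap_smul]

/-- A periodic automorphism of a matrix representation over a separable extension which
normalises the base matrix algebra descends to the base field. -/
lemma exists_descended_matrix (p : ℕ) [Fact p.Prime] [CharP F p] [Algebra.IsSeparable F S]
    {N : ℕ} (hN : 0 < N) (τ : Matrix (Fin N) (Fin N) F → Matrix (Fin N) (Fin N) F)
    {G : Matrix (Fin N) (Fin N) S} (hG : G ^ p = 1)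
    (hτ : ∀ m, (τ m).map (algebraMap F S) * G = G * m.map (algebraMap F S)) :
    ∃ γ : Matrix (Fin N) (Fin N) F, γ.map (algebraMap F S) = G := by
  classical
  have hp0 : p ≠ 0 := (Fact.out : p.Prime).ne_zero
  have : Nonempty (Fin N) := ⟨⟨0, hN⟩⟩
  have hG0 : G ≠ 0 := by
    rintro rfl
    rw [zero_pow hp0] at hG
    exact zero_ne_one hG
  obtain ⟨i, j, hij⟩ : ∃ i j, G i j ≠ 0 := by
    by_contra! h
    exact hG0 (Matrix.ext h)
  obtain ⟨l, hl⟩ : ∃ l : Module.Dual F S, l (G i j) ≠ 0 := by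
    by_contra! h
    exact hij ((Module.forall_dual_apply_eq_zero_iff F _).1 h)
  let γ' : Matrix (Fin N) (Fin N) F := G.map l
  have hγ' : ∀ m, τ m * γ' = γ' * m := by
    intro m
    have h1 : ((τ m).map (algebraMap F S) * G).map l = τ m * γ' := by
      ext a b
      simp only [Matrix.map_apply, Matrix.mul_apply, map_sum, γ']
      exact Finset.sum_congr rfl fun k _ => by rw [← Algebra.smul_def, map_smul, smul_eq_mul]
    have h2 : (G * m.map (algebraMap F S)).map l = γ' * m := by
      ext a b
      simp only [Matrix.map_apply, Matrix.mul_apply, map_sum, γ']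
      exact Finset.sum_congr rfl fun k _ => by
        rw [mul_comm, ← Algebra.smul_def, map_smul, smul_eq_mul, mul_comm]
    rw [← h1, ← h2, hτ]
  let φ : Matrix (Fin N) (Fin N) F →+* Matrix (Fin N) (Fin N) S := (algebraMap F S).mapMatrix
  have hφ : ∀ m, φ m = m.map (algebraMap F S) := fun _ => rfl
  have hinv : G ^ (p - 1) * G = 1 := by rw [← pow_succ, Nat.sub_add_cancel (by omega), hG]
  have hinv' : G * G ^ (p - 1) = 1 := by rw [← pow_succ', Nat.sub_add_cancel (by omega), hG]
  obtain ⟨c, hc⟩ : G ^ (p - 1) * φ γ' ∈ Set.range (Matrix.scalar (Fin N)) := by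
    rw [Matrix.mem_range_scalar_iff_commute_single']
    intro a b
    have hs : Matrix.single a b (1 : S) = φ (Matrix.single a b 1) := by
      simp [hφ, Matrix.map_single]
    rw [hs]
    set m := Matrix.single a b (1 : F)
    have h1 : φ (τ m) * G = G * φ m := hτ m
    have h2 : φ (τ m) * φ γ' = φ γ' * φ m := by rw [← map_mul, hγ', map_mul]
    change φ m * (G ^ (p - 1) * φ γ') = G ^ (p - 1) * φ γ' * φ m
    calc φ m * (G ^ (p - 1) * φ γ') = (G ^ (p - 1) * G) * φ m * (G ^ (p - 1) * φ γ') := by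
          rw [hinv, one_mul]
      _ = G ^ (p - 1) * (G * φ m) * G ^ (p - 1) * φ γ' := by simp only [mul_assoc]
      _ = G ^ (p - 1) * (φ (τ m) * (G * G ^ (p - 1)) * φ γ') := by
          rw [← h1]; simp only [mul_assoc]
      _ = G ^ (p - 1) * φ γ' * φ m := by rw [hinv', mul_one, h2, mul_assoc]
  have hγc : φ γ' = c • G := by
    calc φ γ' = G * (G ^ (p - 1) * φ γ') := by rw [← mul_assoc, hinv', one_mul]
      _ = c • G := by rw [← hc, Matrix.scalar_apply, ← Matrix.smul_one_eq_diagonal]; simp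
  have hc0 : c ≠ 0 := by
    rintro rfl
    rw [zero_smul] at hγc
    have := congrFun (congrFun hγc i) j
    rw [hφ, Matrix.map_apply, Matrix.zero_apply, map_eq_zero] at this
    exact hl this
  have hcp : c ^ p ∈ (algebraMap F S).range := by
    refine ⟨(γ' ^ p) ⟨0, hN⟩ ⟨0, hN⟩, ?_⟩
    have h1 : φ (γ' ^ p) = c ^ p • 1 := by rw [map_pow, hγc, _root_.smul_pow, hG]
    have := congrFun (congrFun h1 ⟨0, hN⟩) ⟨0, hN⟩
    simpa [hφ] using this
  obtain ⟨c₀, rfl⟩ := mem_range_of_isSeparable_of_pow_mem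
    (p := p) (Algebra.IsSeparable.isSeparable F c) hcp
  refine ⟨c₀⁻¹ • γ', ?_⟩
  have h1 : (c₀⁻¹ • γ').map (algebraMap F S) = (algebraMap F S c₀)⁻¹ • φ γ' := by
    ext; simp [hφ]
  rw [h1, hγc, smul_smul, inv_mul_cancel₀ hc0, one_smul]

end Descent

section TensorPower

variable {F A S : Type} [Field F] [Ring A] [Algebra F A] [Field S] [Algebra F S]

/-- The tensor power of a matrix representation. -/
noncomputable def tensorPowerRep (p : ℕ) {q : ℕ} (ρ : A →ₐ[F] Matrix (Fin q) (Fin q) S) :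
    (⨂[F] _ : Fin p, A) →ₐ[F] Matrix (Fin p → Fin q) (Fin p → Fin q) S :=
  PiTensorProduct.liftAlgHom
    { toFun := fun a => Matrix.of fun x y => ∏ k, ρ (a k) (x k) (y k)
      map_update_add' := by
        intro _ a i u v
        ext x y
        simp only [Matrix.of_apply, Matrix.add_apply]
        rw [← Finset.mul_prod_erase _ _ (Finset.mem_univ i),
          ← Finset.mul_prod_erase _ _ (Finset.mem_univ i),
          ← Finset.mul_prod_erase _ _ (Finset.mem_univ i)]
        have h : ∀ w : A, ∏ k ∈ Finset.univ.erase i, ρ (Function.update a i w k) (x k) (y k) =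
            ∏ k ∈ Finset.univ.erase i, ρ (a k) (x k) (y k) := fun w =>
          Finset.prod_congr rfl fun k hk => by rw [Function.update_of_ne (Finset.ne_of_mem_erase hk)]
        simp only [Function.update_self, h, map_add, Matrix.add_apply, add_mul]
      map_update_smul' := by
        intro _ a i c u
        ext x y
        simp only [Matrix.of_apply, Matrix.smul_apply]
        rw [← Finset.mul_prod_erase _ _ (Finset.mem_univ i),
          ← Finset.mul_prod_erase _ _ (Finset.mem_univ i)]
        have h : ∀ w : A, ∏ k ∈ Finset.univ.erase i, ρ (Function.update a i w k) (x k) (y k) =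
            ∏ k ∈ Finset.univ.erase i, ρ (a k) (x k) (y k) := fun w =>
          Finset.prod_congr rfl fun k hk => by rw [Function.update_of_ne (Finset.ne_of_mem_erase hk)]
        simp only [Function.update_self, h, map_smul, Matrix.smul_apply, smul_mul_assoc] }
    (by
      ext x y
      simp only [MultilinearMap.coe_mk, Matrix.of_apply, Pi.one_apply, map_one, Matrix.one_apply,
        funext_iff]
      by_cases h : ∀ k, x k = y k
      · simp [h]
      · rw [if_neg h]
        push Not at h
        obtain ⟨k, hk⟩ := h
        exact Finset.prod_eq_zero (Finset.mem_univ k) (if_neg hk))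
    (by
      intro a b
      ext x y
      simp only [MultilinearMap.coe_mk, Matrix.of_apply, Pi.mul_apply, map_mul, Matrix.mul_apply,
        ← Finset.prod_mul_distrib]
      rw [Finset.prod_univ_sum]
      simp)

lemma tensorPowerRep_tprod (p : ℕ) {q : ℕ} (ρ : A →ₐ[F] Matrix (Fin q) (Fin q) S)
    (a : Fin p → A) (x y : Fin p → Fin q) :
    tensorPowerRep p ρ (PiTensorProduct.tprod F a) x y = ∏ k, ρ (a k) (x k) (y k) := by
  simp [tensorPowerRep]

lemma tensorPowerRep_reindex (p : ℕ) [NeZero p] {q : ℕ} (ρ : A →ₐ[F] Matrix (Fin q) (Fin q) S)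
    (j : Fin p) (e : ⨂[F] _ : Fin p, A) (f : (Fin p → Fin q) → S) :
    (tensorPowerRep p ρ (PiTensorProduct.reindex F (fun _ => A) (Equiv.addRight j) e)).mulVec
      (cyclicShift S p q j f) = cyclicShift S p q j ((tensorPowerRep p ρ e).mulVec f) := by
  induction e using PiTensorProduct.induction_on with
  | smul_tprod c a =>
    rw [map_smul, map_smul, map_smul, Matrix.smul_mulVec, Matrix.smul_mulVec]
    have : PiTensorProduct.reindex F (fun _ => A) (Equiv.addRight j) (PiTensorProduct.tprod F a) =
        PiTensorProduct.tprod F fun k => a (k + -j) := by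
      rw [PiTensorProduct.reindex_tprod]
      congr 1
    rw [this]
    ext x
    simp only [Pi.smul_apply, cyclicShift_apply]
    congr 1
    simp only [Matrix.mulVec, dotProduct, tensorPowerRep_tprod, cyclicShift_apply]
    refine Fintype.sum_equiv ((Equiv.addRight j).symm.arrowCongr (Equiv.refl (Fin q))) _ _ ?_
    intro y
    have h : ∀ k, (Equiv.addRight j).symm.arrowCongr (Equiv.refl (Fin q)) y k = y (k + j) :=
      fun k => rfl
    simp only [h]
    congr 1
    exact Fintype.prod_equiv (Equiv.addRight (-j)) _ _ fun k => by simp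
  | add a b ha hb =>
    simp only [map_add, Matrix.add_mulVec, ha, hb]

lemma finrank_tensorPower [FiniteDimensional F A] (p : ℕ) :
    finrank F (⨂[F] _ : Fin p, A) = finrank F A ^ p := by
  have b := Basis.piTensorProduct fun _ : Fin p => finBasis F A
  rw [finrank_eq_card_basis b]
  simp

end TensorPower

section Frobenius

variable {F A S : Type} [Field F] [Ring A] [Algebra F A] [Field S] [Algebra F S]

lemma algebraMap_comp_mulVec {N : ℕ} (m : Matrix (Fin N) (Fin N) F) (v : Fin N → F) :
    (m.map (algebraMap F S)).mulVec (algebraMap F S ∘ v) = algebraMap F S ∘ m.mulVec v := by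
  ext i
  simp [Matrix.mulVec, dotProduct]

lemma dual_comp_mulVec {N : ℕ} (l : Dual F S) (m : Matrix (Fin N) (Fin N) F) (v : Fin N → S) :
    l ∘ (m.map (algebraMap F S)).mulVec v = m.mulVec (l ∘ v) := by
  ext i
  simp only [Function.comp_apply, Matrix.mulVec, dotProduct, map_sum, Matrix.map_apply]
  exact Finset.sum_congr rfl fun k _ => by rw [← Algebra.smul_def, map_smul, smul_eq_mul]

/-- If `F ⊆ S` are of characteristic `p`, the `p`-th tensor power of an algebra `A` is split and
`A` has a representation of dimension `q` over the separable extension `S`, then `A` has a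
Frobenius-semilinear representation of dimension `q` over `F`. -/
theorem exists_frobenius_semilinear_rep (p : ℕ) [Fact p.Prime] [CharP F p]
    [Algebra.IsSeparable F S] [FiniteDimensional F A] {q : ℕ}
    (hq : finrank F A = q ^ 2)
    (hsplit : IsSplitAlg F (⨂[F] _ : Fin p, A)) (hrep : HasRep F A S q) :
    ∃ χ : A →+* Matrix (Fin q) (Fin q) F, ∀ (c : F) a, χ (c • a) = c ^ p • χ a := by
  classical
  have hp : p.Prime := Fact.out
  have : NeZero p := ⟨hp.ne_zero⟩
  have : CharP S p := charP_of_injective_algebraMap (algebraMap F S).injective p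
  have : ExpChar S p := ExpChar.prime hp
  obtain ⟨N, hN, ⟨ι⟩⟩ := hsplit
  obtain ⟨ρ⟩ := hrep
  have hNq : Fintype.card (Fin p → Fin q) = N := by
    have h := ι.toLinearEquiv.finrank_eq
    rw [finrank_tensorPower, hq, finrank_matrix, finrank_self] at h
    simp only [Fintype.card_fin, mul_one] at h
    have h2 : (q ^ p) ^ 2 = N ^ 2 := by rw [sq N, ← h]; ring
    simpa using Nat.pow_left_injective (n := 2) (by norm_num) h2
  let Φ := tensorPowerRep p ρ
  obtain ⟨T, hT⟩ := exists_intertwiner hN hNq (Φ.comp ι.symm.toAlgHom)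
  have hTι : ∀ e v, T (((ι e).map (algebraMap F S)).mulVec v) = (Φ e).mulVec (T v) := by
    intro e v
    simpa using hT (ι e) v
  -- the shifts descend to matrices over `F`
  have hdesc : ∀ j, ∃ γ : Matrix (Fin N) (Fin N) F, ∀ v,
      T ((γ.map (algebraMap F S)).mulVec v) = cyclicShift S p q j (T v) := by
    intro j
    let L : (Fin N → S) →ₗ[S] (Fin N → S) := T.symm.conj (cyclicShift S p q j)
    have hL : ∀ v, T (L v) = cyclicShift S p q j (T v) := fun v => by
      simp [L, LinearEquiv.conj_apply]
    have hGv : ∀ v, (LinearMap.toMatrixAlgEquiv' L).mulVec v = L v := fun v => by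
      rw [← Matrix.toLinAlgEquiv'_apply, Matrix.toLinAlgEquiv'_toMatrixAlgEquiv']
    obtain ⟨γ, hγ⟩ := exists_descended_matrix p hN
      (fun m => ι (PiTensorProduct.reindex F (fun _ => A) (Equiv.addRight j) (ι.symm m)))
      (G := LinearMap.toMatrixAlgEquiv' L) (by
        have : L ^ p = 1 := by
          ext1
          refine LinearMap.ext fun v => ?_
          have : ∀ n : ℕ, ∀ v, T ((L ^ n) v) = (cyclicShift S p q j ^ n) (T v) := by
            intro n
            induction n with
            | zero => simp
            | succ n ih => intro v; rw [pow_succ, pow_succ, Module.End.mul_apply, ih, hL]; rfl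
          apply T.injective
          simp [this, cyclicShift_pow_self]
        rw [← map_pow, this, map_one]) (by
        intro m
        refine Matrix.ext_of_mulVec_single fun i => ?_
        rw [← Matrix.mulVec_mulVec, ← Matrix.mulVec_mulVec, hGv, hGv]
        apply T.injective
        rw [hTι, hL, hL, tensorPowerRep_reindex]
        congr 1
        rw [← hTι]
        simp)
    exact ⟨γ, fun v => by rw [hγ, hGv, hL]⟩
  choose γ hγ using hdesc
  -- the diagonal map and the `F`-structure on its target
  let D : ((Fin p → Fin q) → S) →ₗ[S] (Fin q → S) := LinearMap.funLeft S S fun i _ => i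
  have hD : ∀ f i, D f i = f fun _ => i := fun f i => rfl
  let up : (Fin N → F) →ₗ[F] (Fin N → S) := LinearMap.compLeft (Algebra.linearMap F S) (Fin N)
  have hup : ∀ v, up v = algebraMap F S ∘ v := fun v => rfl
  let δ : (Fin N → F) →ₗ[F] (Fin q → S) :=
    (D.restrictScalars F) ∘ₗ (T.toLinearMap.restrictScalars F) ∘ₗ up
  have hδ : ∀ v, δ v = D (T (up v)) := fun v => rfl
  let W : Submodule F (Fin N → F) :=
    ⨅ j, LinearMap.ker (Matrix.toLin' (γ j) - LinearMap.id)
  have hWγ : ∀ v, v ∈ W ↔ ∀ j, (γ j).mulVec v = v := by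
    intro v
    simp [W, sub_eq_zero]
  have hTup : ∀ j v, cyclicShift S p q j (T (up v)) = T (up ((γ j).mulVec v)) := by
    intro j v
    rw [← hγ, hup, hup, algebraMap_comp_mulVec]
  have hup_inj : Function.Injective up := fun v w h => by
    funext i
    exact (algebraMap F S).injective (congrFun h i)
  have hWinv : ∀ v, v ∈ W ↔ ∀ j, cyclicShift S p q j (T (up v)) = T (up v) := by
    intro v
    rw [hWγ]
    refine forall_congr' fun j => ?_
    rw [hTup]
    exact ⟨fun h => by rw [h], fun h => hup_inj (T.injective h)⟩
  let U : Submodule F (Fin q → S) := W.map δ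
  let frob : A →+* Matrix (Fin q) (Fin q) S := (frobenius S p).mapMatrix.comp ρ.toRingHom
  have hfrob : ∀ a i k, frob a i k = ρ a i k ^ p := fun a i k => rfl
  -- the action of `A` on invariants
  let t : A → ⨂[F] _ : Fin p, A := fun a => PiTensorProduct.tprod F fun _ => a
  have htinv : ∀ a f, (∀ j, cyclicShift S p q j f = f) →
      ∀ j, cyclicShift S p q j ((Φ (t a)).mulVec f) = (Φ (t a)).mulVec f := by
    intro a f hf j
    have h := tensorPowerRep_reindex p ρ j (t a) f
    rw [PiTensorProduct.reindex_tprod, hf] at h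
    exact h.symm
  have hDt : ∀ a f, (∀ j, cyclicShift S p q j f = f) →
      D ((Φ (t a)).mulVec f) = (frob a).mulVec (D f) := by
    intro a f hf
    ext i
    rw [hD]
    simp only [Matrix.mulVec, dotProduct, hfrob, hD, Φ, t, tensorPowerRep_tprod]
    rw [sum_eq_sum_const (p := p) (f := fun x => (∏ k, ρ a i (x k)) * f x)]
    · simp
    · intro j
      ext x
      have h1 := congrFun (hf j) x
      rw [cyclicShift_apply] at h1 ⊢
      rw [h1]
      congr 1
      exact Equiv.prod_comp (Equiv.addRight j) fun k => ρ a i (x k)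
  have hU : ∀ a, ∀ u ∈ U, (frob a).mulVec u ∈ U := by
    rintro a _ ⟨v, hv, rfl⟩
    have hv' := (hWinv v).1 hv
    have h1 : T (up ((ι (t a)).mulVec v)) = (Φ (t a)).mulVec (T (up v)) := by
      rw [← hTι, hup, hup, algebraMap_comp_mulVec]
    refine ⟨(ι (t a)).mulVec v, (hWinv _).2 ?_, ?_⟩
    · rw [h1]
      exact htinv a _ hv'
    · rw [hδ, hδ, h1, hDt a _ hv']
  -- linear independence over `F` implies linear independence over `S`
  let b := Basis.ofVectorSpace F U
  have hli : LinearIndependent S fun k => (b k : Fin q → S) := by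
    rw [linearIndependent_iff']
    intro s g hg k hk
    rw [← Module.forall_dual_apply_eq_zero_iff F]
    intro l
    choose w hwW hw using fun k => (b k).2
    let f := T (∑ k ∈ s, g k • up (w k))
    have hf : f = ∑ k ∈ s, g k • T (up (w k)) := by simp [f]
    have hinv : ∀ j, cyclicShift S p q j f = f := by
      intro j
      rw [hf, map_sum]
      exact Finset.sum_congr rfl fun k _ => by rw [map_smul, (hWinv _).1 (hwW k)]
    have hzero : ∀ i, f (fun _ => i) = 0 := by
      intro i
      change D f i = 0
      rw [hf, map_sum]
      simp only [map_smul, ← hδ, hw]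
      rw [hg]; rfl
    obtain ⟨z, hz⟩ := exists_sum_cyclicShift_eq hinv hzero
    have h1 : ∑ k ∈ s, g k • up (w k) =
        ∑ j, ((γ j).map (algebraMap F S)).mulVec (T.symm z) := by
      apply T.injective
      change f = _
      rw [map_sum]
      simp only [hγ, LinearEquiv.apply_symm_apply]
      exact hz.symm
    have h2 : ∑ k ∈ s, l (g k) • w k = ∑ j, (γ j).mulVec (l ∘ T.symm z) := by
      simp only [← dual_comp_mulVec]
      funext i
      have h4 := congrArg (fun v : Fin N → S => l (v i)) h1
      simp only [Function.comp_apply, Finset.sum_apply, map_sum, Pi.smul_apply] at h4 ⊢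
      rw [← h4]
      refine Finset.sum_congr rfl fun k _ => ?_
      rw [hup, Function.comp_apply, smul_eq_mul, smul_eq_mul, mul_comm (g k), ← Algebra.smul_def,
        map_smul, smul_eq_mul, mul_comm]
    have h5 : ∑ k ∈ s, l (g k) • (b k : Fin q → S) = 0 := by
      simp only [← hw, ← map_smul, ← map_sum]
      rw [h2, map_sum]
      simp only [hδ, ← hTup]
      rw [← map_sum]
      funext i
      rw [hD]
      exact sum_cyclicShift_const _ i
    have h6 : ∑ k ∈ s, l (g k) • b k = 0 := by
      apply Subtype.ext
      simpa using h5
    exact linearIndependent_iff'.1 b.linearIndependent s _ h6 k hk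
  have hspanU : ∀ f, (∀ j, cyclicShift S p q j f = f) → D f ∈ Submodule.span S (U : Set _) := by
    intro f hf
    obtain ⟨v, rfl⟩ := T.surjective f
    let β := Basis.ofVectorSpace F S
    let s := Finset.univ.biUnion fun k => (β.repr (v k)).support
    have hv : v = ∑ i ∈ s, β i • up (β.coord i ∘ v) := by
      funext k
      have h1 := β.linearCombination_repr (v k)
      rw [Finsupp.linearCombination_apply, Finsupp.sum_of_support_subset _
        (Finset.subset_biUnion_of_mem (fun k => (β.repr (v k)).support) (Finset.mem_univ k)) _
        (by simp)] at h1
      conv_lhs => rw [← h1]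
      rw [Finset.sum_apply]
      refine Finset.sum_congr rfl fun i _ => ?_
      simp [hup, Algebra.smul_def, mul_comm]
    have hW : ∀ i, β.coord i ∘ v ∈ W := by
      intro i
      rw [hWγ]
      intro j
      rw [← dual_comp_mulVec]
      congr 1
      apply T.injective
      rw [hγ, hf]
    rw [hv, map_sum, map_sum]
    refine Submodule.sum_mem _ fun i _ => ?_
    rw [map_smul, map_smul]
    exact Submodule.smul_mem _ _ (Submodule.subset_span ⟨_, hW i, rfl⟩)
  have hspan : ⊤ ≤ Submodule.span S (Set.range fun k => (b k : Fin q → S)) := by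
    have h1 : Submodule.span S (U : Set (Fin q → S)) ≤
        Submodule.span S (Set.range fun k => (b k : Fin q → S)) := by
      rw [Submodule.span_le]
      intro u hu
      have h2 : (⟨u, hu⟩ : U) ∈ Submodule.span F (Set.range b) := by
        rw [b.span_eq]; trivial
      have h3 := Submodule.mem_map_of_mem (f := U.subtype) h2
      rw [Submodule.map_span, ← Set.range_comp] at h3
      exact Submodule.span_le_restrictScalars F S _ h3
    refine le_trans ?_ h1
    intro y _
    have hy := hspanU (fun x => if ∀ k, x k = x 0 then y (x 0) else 0) (by
      intro j
      ext x
      have h : (∀ k, x (k + j) = x (0 + j)) ↔ ∀ k, x k = x 0 := by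
        constructor
        · intro h k
          have h1 := h (k - j)
          have h2 := h (0 - j)
          rw [sub_add_cancel] at h1 h2
          rw [h1, h2]
        · intro h k
          rw [h, h (0 + j)]
      rw [cyclicShift_apply]
      simp only [h]
      split_ifs with h'
      · rw [h' (0 + j)]
      · rfl)
    convert hy using 1
    funext i
    simp [hD]
  let bS := Basis.mk hli hspan
  let e := bS.indexEquiv (Pi.basisFun S (Fin q))
  let χ₀ : A →+* Module.End F U :=
    { toFun := fun a => ((Matrix.toLin' (frob a)).restrictScalars F).restrict (hU a)
      map_one' := by
        ext1 u
        apply Subtype.ext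
        change (frob 1).mulVec u = u
        simp
      map_zero' := by
        ext1 u
        apply Subtype.ext
        change (frob 0).mulVec u = 0
        simp
      map_mul' := fun a a' => by
        ext1 u
        apply Subtype.ext
        change (frob (a * a')).mulVec u = (frob a).mulVec ((frob a').mulVec u)
        simp
      map_add' := fun a a' => by
        ext1 u
        apply Subtype.ext
        change (frob (a + a')).mulVec u = (frob a).mulVec u + (frob a').mulVec u
        rw [map_add, Matrix.add_mulVec] }
  have hχ₀ : ∀ (c : F) a, χ₀ (c • a) = c ^ p • χ₀ a := by
    intro c a
    ext1 u
    apply Subtype.ext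
    change (frob (c • a)).mulVec u = c ^ p • (frob a).mulVec u
    rw [← Matrix.smul_mulVec]
    congr 1
    ext i k
    simp [hfrob, _root_.smul_pow]
  refine ⟨(LinearMap.toMatrixAlgEquiv (b.reindex e)).toAlgHom.toRingHom.comp χ₀, fun c a => ?_⟩
  simp [hχ₀]

end Frobenius

section SplittingTower

theorem HasIndex.le_of_hasRep {K B N : Type} [Field K] [Ring B] [Algebra K B] [Field N]
    [Algebra K N] [FiniteDimensional K N] {e q : ℕ} (h : HasIndex K B e) (hq0 : 0 < q)
    (hq : finrank K B = q ^ 2) (hrep : HasRep K B N q) : e ≤ finrank K N := by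
  obtain ⟨ρ⟩ := hrep
  have : Nonempty (Fin q) := ⟨⟨0, hq0⟩⟩
  let g : Matrix (Fin q) (Fin q) N →ₐ[K] Module.End K (Fin q → N) :=
    { toFun := fun m => (Matrix.toLin' m).restrictScalars K
      map_one' := LinearMap.ext fun v => by simp
      map_mul' := fun a b => LinearMap.ext fun v => by simp
      map_zero' := LinearMap.ext fun v => by simp
      map_add' := fun a b => LinearMap.ext fun v => by simp
      commutes' := fun c => by
        refine LinearMap.ext fun v => ?_
        rw [Algebra.algebraMap_eq_smul_one, Algebra.algebraMap_eq_smul_one]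
        simp [Matrix.smul_mulVec] }
  have := h.mul_le_finrank hq (g.comp ρ)
  rw [finrank_pi_fintype] at this
  simp only [Finset.sum_const, Finset.card_univ, Fintype.card_fin, smul_eq_mul] at this
  exact Nat.le_of_mul_le_mul_left this hq0

theorem IsSplitAlg.hasRep {K B : Type} [Field K] [Ring B] [Algebra K B] {q : ℕ}
    (h : IsSplitAlg K B) (hq : finrank K B = q ^ 2) : HasRep K B K q := by
  obtain ⟨m, -, ⟨φ⟩⟩ := h
  have hm : m = q := by
    have := φ.toLinearEquiv.finrank_eq
    rw [hq, finrank_matrix, finrank_self] at this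
    refine Nat.pow_left_injective (n := 2) (by norm_num) ?_
    simp only [Fintype.card_fin, mul_one] at this ⊢
    rw [this, sq]
  subst hm
  exact ⟨φ.toAlgHom⟩

theorem IsSplitAlg.hasIndex_one {K B : Type} [Field K] [Ring B] [Algebra K B]
    (h : IsSplitAlg K B) : HasIndex K B 1 := by
  obtain ⟨m, hm, hφ⟩ := h
  exact ⟨K, inferInstance, inferInstance, m, hm, hφ, by simp⟩

theorem HasIndex.le_of_baseChange {F A K : Type} [Field F] [Ring A] [Algebra F A]
    [FiniteDimensional F A] [Field K] [Algebra F K] {e d q : ℕ} (hq0 : 0 < q)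
    (hq : finrank F A = q ^ 2) (h : HasIndex F A d) (hK : HasIndex K (K ⊗[F] A) e) : e ≤ d := by
  obtain ⟨D, _, _, m, hm, ⟨φ⟩, hD, hmd⟩ := h.mul_eq_of_finrank hq
  have hd : 0 < d := by
    rcases Nat.eq_zero_or_pos d with rfl | h
    · omega
    · exact h
  have : Nonempty (Fin m) := ⟨⟨0, hm⟩⟩
  have : FiniteDimensional F D := FiniteDimensional.of_finrank_pos (by rw [hD]; positivity)
  let g : Matrix (Fin m) (Fin m) D →ₐ[F] Module.End F (Fin m → D) :=
    { toFun := fun M =>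
        { toFun := fun v => M.mulVec v
          map_add' := fun v w => Matrix.mulVec_add _ _ _
          map_smul' := fun c v => Matrix.mulVec_smul _ _ _ }
      map_one' := LinearMap.ext fun v => by simp
      map_mul' := fun a b => LinearMap.ext fun v => by simp
      map_zero' := LinearMap.ext fun v => by simp
      map_add' := fun a b => LinearMap.ext fun v => by simp [Matrix.add_mulVec]
      commutes' := fun c => by
        refine LinearMap.ext fun v => ?_
        rw [Algebra.algebraMap_eq_smul_one, Algebra.algebraMap_eq_smul_one]
        simp [Matrix.smul_mulVec] }
  let ρ : K ⊗[F] A →ₐ[K] Module.End K (K ⊗[F] (Fin m → D)) :=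
    Algebra.TensorProduct.lift (Algebra.ofId K _)
      ((Module.End.baseChangeHom F K (Fin m → D)).comp (g.comp φ.toAlgHom))
      fun x y => Algebra.commutes _ _
  have h1 := hK.mul_le_finrank (q := q) (by rw [finrank_baseChange, hq]) ρ
  rw [finrank_baseChange, finrank_pi_fintype] at h1
  simp only [Finset.sum_const, Finset.card_univ, Fintype.card_fin, smul_eq_mul, hD] at h1
  rw [sq, ← mul_assoc, hmd] at h1
  exact Nat.le_of_mul_le_mul_left h1 hq0

variable {p : ℕ} [hp : Fact p.Prime] {F Ω : Type} [Field F] [CharP F p] [Field Ω] [Algebra F Ω]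

theorem HasIndex.le_of_hasRep_sup {A : Type} [Ring A] [Algebra F A] {K L : IntermediateField F Ω}
    [FiniteDimensional F K] [FiniteDimensional F L] {e q : ℕ} (hq0 : 0 < q)
    (hq : finrank F A = q ^ 2) (hrep : HasRep F A (L ⊔ K : IntermediateField F Ω) q)
    (h : HasIndex K (K ⊗[F] A) e) : e ≤ finrank F L := by
  let N := IntermediateField.extendScalars (le_sup_right : K ≤ L ⊔ K)
  have hfd : FiniteDimensional F N :=
    inferInstanceAs (FiniteDimensional F (L ⊔ K : IntermediateField F Ω))
  have hfd' : FiniteDimensional K N := FiniteDimensional.right F K N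
  have hrep' : HasRep F A N q := hrep
  have h1 := h.le_of_hasRep hq0 (by rw [finrank_baseChange, hq]) (hasRep_baseChange_iff.2 hrep')
  have hfree : Free K N := Free.of_divisionRing K N
  have h2 : finrank F K * finrank K N = finrank F N := finrank_mul_finrank F K N
  have h3 : finrank F N ≤ finrank F L * finrank F K := IntermediateField.finrank_sup_le L K
  have h4 : 0 < finrank F K := finrank_pos
  rw [← h2, mul_comm] at h3
  exact h1.trans (Nat.le_of_mul_le_mul_right h3 h4)

theorem hasRep_pthRoots_of_isSeparable [IsAlgClosed Ω] {A S : Type} [Ring A] [Algebra F A]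
    [FiniteDimensional F A] [Field S] [Algebra F S] [Algebra.IsSeparable F S] {q : ℕ}
    (hq : finrank F A = q ^ 2) (hsplit : IsSplitAlg F (⨂[F] _ : Fin p, A))
    (hrep : HasRep F A S q) : HasRep F A (pthRoots p F Ω) q := by
  have hchar : CharP Ω p := charP_of_injective_algebraMap (algebraMap F Ω).injective p
  have hexpΩ : ExpChar Ω p := ExpChar.prime hp.out
  obtain ⟨χ, hχ⟩ := exists_frobenius_semilinear_rep p hq hsplit hrep
  let g₀ : F →+* Ω := (frobeniusEquiv Ω p).symm.toRingHom.comp (algebraMap F Ω)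
  have hg₀ : ∀ c, g₀ c ^ p = algebraMap F Ω c := fun c => frobeniusEquiv_symm_pow_p Ω p _
  let g : F →+* pthRoots p F Ω :=
    g₀.codRestrict (pthRoots p F Ω) fun c => mem_pthRoots.2 ⟨c, (hg₀ c).symm⟩
  have hg : ∀ c, g (c ^ p) = algebraMap F (pthRoots p F Ω) c := by
    intro c
    apply Subtype.ext
    change g₀ (c ^ p) = algebraMap F Ω c
    rw [map_pow, hg₀]
  refine ⟨{ g.mapMatrix.comp χ with commutes' := fun c => ?_ }⟩
  change g.mapMatrix (χ (algebraMap F A c)) = _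
  rw [Algebra.algebraMap_eq_smul_one, hχ, map_one, Algebra.algebraMap_eq_smul_one]
  ext i j
  by_cases h : i = j
  · subst h
    simp only [RingHom.mapMatrix_apply, Matrix.map_apply, Matrix.smul_apply, Matrix.one_apply_eq,
      smul_eq_mul, mul_one, hg]
    rw [Algebra.algebraMap_eq_smul_one]
  · simp [h]

theorem IsPCyclicReducible.hasRep_pthRoots [IsAlgClosed Ω] [Algebra.IsAlgebraic F Ω]
    (hred : IsPCyclicReducible p F) {A : Type} [Ring A] [Algebra F A] (hA : IsCSA F A)
    (hexp : HasExponent F A p) {q : ℕ} (hq : finrank F A = q ^ 2) :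
    HasRep F A (pthRoots p F Ω) q := by
  have := hA.2.2
  have hchar : CharP Ω p := charP_of_injective_algebraMap (algebraMap F Ω).injective p
  rcases hred.exists_norm_criterion (Ω := Ω) hA hexp hq ⊥ (by
      intro z hz
      obtain ⟨c, rfl⟩ := IntermediateField.mem_bot.1 hz
      exact ⟨c ^ p, map_pow _ _ _⟩) with h | ⟨d, -, -, L, hL, -, r, b, hr, hb, -, hN⟩
  · have h1 : HasRep F A (⊥ : IntermediateField F Ω) q :=
      hasRep_baseChange_iff.1 (h.hasRep (by rw [finrank_baseChange, hq]))
    exact h1.mono (IntermediateField.inclusion bot_le)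
  · have hLS : L ⊔ ⊥ ≤ separableClosure F Ω := by
      rw [sup_bot_eq]
      exact (le_separableClosure_iff F Ω L).2 hL
    have hrS : r ∈ separableClosure F Ω := by
      rw [sup_bot_eq] at hr
      have h1 : IsSeparable L r := by
        refine isSeparable_of_derivative_ne_zero (g := asPoly p ⟨r ^ p - r, hr⟩) ?_ ?_
        · have ha : algebraMap L Ω ⟨r ^ p - r, hr⟩ = r ^ p - r := rfl
          simp [asPoly, ha]
        · simp [asPoly, derivative_X_pow]
      exact mem_separableClosure_iff.2 (IsSeparable.of_algebra_isSeparable_of_isSeparable F h1)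
    have hcharS : CharP (separableClosure F Ω) p :=
      charP_of_injective_algebraMap (algebraMap F (separableClosure F Ω)).injective p
    have hrep : HasRep F A (separableClosure F Ω) q := by
      rw [hN _ hLS]
      obtain ⟨B, hB⟩ := exists_normEq_of_root (p := p)
        (a := (⟨r, hrS⟩ : separableClosure F Ω) ^ p - ⟨r, hrS⟩) (r := ⟨r, hrS⟩) rfl ⟨b, hLS hb⟩
      exact ⟨B, (normEq_iff (Ω := Ω) (r := r) rfl).1 hB⟩
    exact hasRep_pthRoots_of_isSeparable hq hexp.2.1 hrep

/-- The properties of the fields in the splitting tower of `A`. -/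
structure IsSplittingStage (p : ℕ) [Fact p.Prime] (F Ω : Type) [Field F] [CharP F p] [Field Ω]
    [Algebra F Ω] (A : Type) [Ring A] [Algebra F A] (n i : ℕ) (K : IntermediateField F Ω) :
    Prop where
  eq_bot : i = 0 → K = ⊥
  le_pthRoots : K ≤ pthRoots p F Ω
  finiteDimensional : FiniteDimensional F K
  index_le : ∀ e, HasIndex K (K ⊗[F] A) e → e ≤ p ^ (n - i)
  finrank_le : 1 ≤ i → finrank F K ≤ p ^ (2 * p ^ (n - 1) - p ^ (n - i))

theorem IsSplittingStage.exists_succ [IsAlgClosed Ω] [Algebra.IsAlgebraic F Ω]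
    (hred : IsPCyclicReducible p F) {A : Type} [Ring A] [Algebra F A] (hA : IsCSA F A)
    (hexp : HasExponent F A p) {q : ℕ} (hq0 : 0 < q) (hq : finrank F A = q ^ 2) {n i : ℕ}
    (hi : i < n) {K : IntermediateField F Ω} (hK : IsSplittingStage p F Ω A n i K) :
    ∃ K', K ≤ K' ∧ IsSplittingStage p F Ω A n (i + 1) K' := by
  have hfdK := hK.finiteDimensional
  have hp0 : 0 < p := hp.out.pos
  have hpow : p ^ (n - i) = p * p ^ (n - (i + 1)) := by
    rw [← pow_succ']
    congr 1
    omega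
  rcases hred.exists_norm_criterion hA hexp hq K (fun z hz => mem_pthRoots.1 (hK.le_pthRoots hz))
    with h | ⟨d, hd0, hd, L, hL, hLd, r, b, hr, hb, hb0, hN⟩
  · have hle : 2 * p ^ (n - 1) - p ^ (n - i) ≤ 2 * p ^ (n - 1) - p ^ (n - (i + 1)) := by
      have := Nat.pow_le_pow_right hp0 (show n - (i + 1) ≤ n - i by omega)
      omega
    refine ⟨K, le_rfl, by simp, hK.le_pthRoots, hfdK, fun e he => ?_, fun _ => ?_⟩
    · have h1 := he.le_of_hasRep hq0 (by rw [finrank_baseChange, hq])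
        (h.hasRep (by rw [finrank_baseChange, hq]))
      rw [finrank_self] at h1
      exact h1.trans (Nat.one_le_pow _ _ hp0)
    · rcases Nat.eq_zero_or_pos i with rfl | hi0
      · rw [hK.eq_bot rfl, IntermediateField.finrank_bot]
        exact Nat.one_le_pow _ _ hp0
      · exact (hK.finrank_le hi0).trans (Nat.pow_le_pow_right hp0 hle)
  · have hdle : d ≤ p ^ (n - (i + 1)) := by
      have := hK.index_le _ hd
      rw [hpow] at this
      exact Nat.le_of_mul_le_mul_left this hp0
    have hfdL : FiniteDimensional F L := FiniteDimensional.of_finrank_pos (hLd ▸ hd0)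
    obtain ⟨K', hKK', hK', hfdK', hdeg, B, hB⟩ : ∃ K' : IntermediateField F Ω, K ≤ K' ∧
        K' ≤ pthRoots p F Ω ∧ FiniteDimensional F K' ∧
        finrank F K' ≤ p ^ (2 * p ^ (n - 1) - p ^ (n - (i + 1))) ∧
        ∃ B : (L ⊔ K' : IntermediateField F Ω)[X],
          ∏ k ∈ Finset.range p, aeval (r - (k : Ω)) B = b := by
      rcases Nat.eq_zero_or_pos i with rfl | hi0
      · obtain rfl := hK.eq_bot rfl
        rw [sup_bot_eq] at hb
        obtain ⟨K', h1, h2, h3, h4⟩ := exists_norm_descent_bot (p := p) r hb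
        refine ⟨K', bot_le, h1, h2, h3.trans (Nat.pow_le_pow_right hp0 ?_), h4⟩
        rw [hLd]
        simp only [zero_add] at hdle ⊢
        omega
      · have hrep : HasRep F A (L ⊔ pthRoots p F Ω : IntermediateField F Ω) q :=
          (hred.hasRep_pthRoots hA hexp hq).mono (IntermediateField.inclusion le_sup_right)
        obtain ⟨B, hB⟩ := (hN _ (sup_le_sup_left hK.le_pthRoots L)).1 hrep
        obtain ⟨K', h0, h1, h2, h3, h4⟩ := exists_norm_descent hK.le_pthRoots hr hb hb0 rfl B hB
        refine ⟨K', h0, h1, h2, h3.trans ?_, h4⟩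
        refine (Nat.mul_le_mul_right _ (hK.finrank_le hi0)).trans ?_
        rw [← pow_add, hLd]
        refine Nat.pow_le_pow_right hp0 ?_
        have h5 : p ^ (n - i) ≤ p ^ (n - 1) := Nat.pow_le_pow_right hp0 (by omega)
        have h6 : (p - 1) * d ≤ (p - 1) * p ^ (n - (i + 1)) := Nat.mul_le_mul_left _ hdle
        have h7 : (p - 1) * p ^ (n - (i + 1)) + p ^ (n - (i + 1)) = p ^ (n - i) := by
          rw [hpow, ← Nat.succ_mul, Nat.succ_eq_add_one, Nat.sub_add_cancel hp0]
        omega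
    refine ⟨K', hKK', by simp, hK', hfdK', fun e he => ?_, fun _ => hdeg⟩
    have hrep := (hN _ (sup_le_sup_left hKK' L)).2 ⟨B, hB⟩
    exact (HasIndex.le_of_hasRep_sup hq0 hq hrep he).trans (hLd.trans_le hdle)

theorem exists_splittingStages [IsAlgClosed Ω] [Algebra.IsAlgebraic F Ω]
    (hred : IsPCyclicReducible p F) {A : Type} [Ring A] [Algebra F A] (hA : IsCSA F A)
    (hexp : HasExponent F A p) {q : ℕ} (hq0 : 0 < q) (hq : finrank F A = q ^ 2) {n : ℕ}
    (hind : HasIndex F A (p ^ n)) :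
    ∃ K : ℕ → IntermediateField F Ω, (∀ i, K i ≤ K (i + 1)) ∧
      ∀ i ≤ n, IsSplittingStage p F Ω A n i (K i) := by
  have := hA.2.2
  have h0 : IsSplittingStage p F Ω A n 0 (⊥ : IntermediateField F Ω) :=
    ⟨fun _ => rfl, bot_le, inferInstance, fun e he => HasIndex.le_of_baseChange hq0 hq hind he,
      by simp⟩
  have hstep : ∀ i (K : IntermediateField F Ω), ∃ K', K ≤ K' ∧
      (i < n → IsSplittingStage p F Ω A n i K → IsSplittingStage p F Ω A n (i + 1) K') := by
    intro i K
    by_cases h : i < n ∧ IsSplittingStage p F Ω A n i K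
    · obtain ⟨K', h1, h2⟩ := h.2.exists_succ hred hA hexp hq0 hq h.1
      exact ⟨K', h1, fun _ _ => h2⟩
    · exact ⟨K, le_rfl, fun h1 h2 => absurd ⟨h1, h2⟩ h⟩
  choose g hle hg using hstep
  refine ⟨fun i => Nat.rec ⊥ g i, fun i => hle i _, fun i => ?_⟩
  induction i with
  | zero => exact fun _ => h0
  | succ i ih => exact fun hi => hg i _ (by omega) (ih (by omega))

end SplittingTower

end Auxiliary

/-- Over a `p`-cyclic reducible field `F` of characteristic `p`, if `A` is
central simple of exponent `p` and index `p ^ n`, then there is a chain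
`F = K₀ ⊆ K₁ ⊆ ⋯ ⊆ Kₙ` of purely inseparable extensions of `F` with `Kᵢ ^ p ⊆ F`,
`ind A_{Kᵢ} ≤ p ^ (n - i)` and `[Kᵢ:F] ≤ p ^ (2 p^(n-1) - p^(n-i))` for `1 ≤ i ≤ n`. -/
theorem statement7 (p : ℕ) (hp : p.Prime) (F : Type) [Field F] [CharP F p]
    (hred : IsPCyclicReducible p F)
    (A : Type) [Ring A] [Algebra F A] (hA : IsCSA F A) (hexp : HasExponent F A p)
    (n : ℕ) (hn : 0 < n) (hind : HasIndex F A (p ^ n)) :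
    ∃ (K : Fin (n + 1) → Type) (_ : ∀ i, Field (K i)) (_ : ∀ i, Algebra F (K i))
      (_ : ∀ i : Fin n, K i.castSucc →ₐ[F] K i.succ),
      Nonempty ((K 0) ≃ₐ[F] F) ∧
      ∀ i : Fin (n + 1), 1 ≤ i.val →
        IsPurelyInseparable F (K i) ∧ FiniteDimensional F (K i) ∧
        (∀ z : K i, z ^ p ∈ (algebraMap F (K i)).range) ∧
        IndexLE (K i) ((K i) ⊗[F] A) (p ^ (n - i.val)) ∧
        Module.finrank F (K i) ≤ p ^ (2 * p ^ (n - 1) - p ^ (n - i.val)) := by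
  have : Fact p.Prime := ⟨hp⟩
  have : ExpChar F p := ExpChar.prime hp
  obtain ⟨q, hq0, hq⟩ : ∃ q, 0 < q ∧ Module.finrank F A = q ^ 2 := by
    obtain ⟨D, _, _, m, hm, ⟨φ⟩, hD⟩ := hind
    refine ⟨m * p ^ n, Nat.mul_pos hm (Nat.pow_pos hp.pos), ?_⟩
    rw [φ.toLinearEquiv.finrank_eq, Module.finrank_matrix, hD, Fintype.card_fin]
    ring
  obtain ⟨K, hK, hst⟩ :=
    exists_splittingStages (Ω := AlgebraicClosure F) hred hA hexp hq0 hq hind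
  refine ⟨fun i => K i, fun i => inferInstance, fun i => inferInstance,
    fun i => IntermediateField.inclusion (hK i), ?_, fun i hi => ?_⟩
  · have h0 : K 0 = ⊥ := (hst 0 (Nat.zero_le n)).eq_bot rfl
    exact ⟨(IntermediateField.equivOfEq h0).trans (IntermediateField.botEquiv F _)⟩
  · have hi' := hst i (Nat.lt_succ_iff.1 i.2)
    have hpow : ∀ z : K i, z ^ p ∈ (algebraMap F (K i)).range := by
      intro z
      obtain ⟨c, hc⟩ := mem_pthRoots.1 (hi'.le_pthRoots z.2)
      exact ⟨c, Subtype.ext hc⟩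
    refine ⟨(isPurelyInseparable_iff_pow_mem F p).2 fun z => ⟨1, by simpa using hpow z⟩,
      hi'.finiteDimensional, hpow, ?_, hi'.finrank_le hi⟩
    rcases hred.exists_norm_criterion hA hexp hq (K i)
      (fun z hz => mem_pthRoots.1 (hi'.le_pthRoots hz)) with h | ⟨d, -, hd, -⟩
    · exact ⟨1, Nat.one_le_pow _ _ hp.pos, h.hasIndex_one⟩
    · exact ⟨_, hi'.index_le _ hd, hd⟩
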